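/- arXiv:0907.3855 — 4 statements merged into one kernel-verified Lean document; each statement's English description precedes it below -/
import Mathlib

section
/- Let p be a prime, R a commutative ring of characteristic p, and R[𝔛] the graded polynomial ring in variables x_1,…,x_m with deg x_i = p^{d_i}. Let I ⊆ R[𝔛] be a twisted-linear ideal generated by twisted-linear elements of degree ≤ p^n. Then R[𝔛]/I is flat over R if and only if the R-modules FPV_m(R)/(FPV_m(R) ∩ I) are flat over R for all m = 0, 1, …, n. -/
open MvPolynomial

/-- `FPV p R mv d l` is the `R`-submodule of the polynomial ring `R[x_1,…,x_mv]`
(graded by `deg x_i = p^{d i}`) spanned by the twisted-linear monomials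
`x_i ^ p^(l - d i)` for those `i` with `d i ≤ l`. -/
noncomputable def FPV (p : ℕ) (R : Type*) [CommRing R] (mv : ℕ) (d : Fin mv → ℕ) (l : ℕ) :
    Submodule R (MvPolynomial (Fin mv) R) :=
  Submodule.span R {f | ∃ i : Fin mv, d i ≤ l ∧ f = X i ^ p ^ (l - d i)}

namespace TwLin

/-- twisted-linear monomials of level `m` with index in `s` -/
noncomputable def TW (p : ℕ) (R : Type*) [CommRing R] {mv : ℕ} (d : Fin mv → ℕ) (m : ℕ)
    (s : Set (Fin mv)) : Submodule R (MvPolynomial (Fin mv) R) :=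
  Submodule.span R {f | ∃ i : Fin mv, d i ≤ m ∧ i ∈ s ∧ f = X i ^ p ^ (m - d i)}

section
variable {p : ℕ} {R : Type*} [CommRing R] {mv : ℕ} {d : Fin mv → ℕ}

lemma TW_mono {m : ℕ} {s t : Set (Fin mv)} (h : ∀ i, d i ≤ m → i ∈ s → i ∈ t) :
    TW p R d m s ≤ TW p R d m t := by
  apply Submodule.span_mono
  rintro f ⟨i, h1, h2, rfl⟩
  exact ⟨i, h1, h i h1 h2, rfl⟩

lemma X_mem_TW {m : ℕ} {s : Set (Fin mv)} {i : Fin mv} (h1 : d i ≤ m) (h2 : i ∈ s) :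
    (X i ^ p ^ (m - d i) : MvPolynomial (Fin mv) R) ∈ TW p R d m s :=
  Submodule.subset_span ⟨i, h1, h2, rfl⟩

lemma TW_le_FPV {m : ℕ} {s : Set (Fin mv)} : TW p R d m s ≤ FPV p R mv d m := by
  apply Submodule.span_mono
  rintro f ⟨i, h1, h2, rfl⟩
  exact ⟨i, h1, rfl⟩

lemma TW_pow [Fact p.Prime] [CharP R p] {m : ℕ} {s : Set (Fin mv)} (k : ℕ)
    {h : MvPolynomial (Fin mv) R} (hh : h ∈ TW p R d m s) :
    h ^ p ^ k ∈ TW p R d (m + k) (s ∩ {i | d i ≤ m}) := by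
  have hp0 : p ^ k ≠ 0 := pow_ne_zero _ (Fact.out : p.Prime).ne_zero
  induction hh using Submodule.span_induction with
  | mem x hx =>
    obtain ⟨i, h1, h2, rfl⟩ := hx
    rw [← pow_mul, ← pow_add]
    have : m - d i + k = m + k - d i := by omega
    rw [this]
    exact X_mem_TW (by omega) ⟨h2, h1⟩
  | zero => rw [zero_pow hp0]; exact zero_mem _
  | add x y _ _ hx hy => rw [add_pow_char_pow]; exact add_mem hx hy
  | smul a x _ hx => rw [smul_pow]; exact Submodule.smul_mem _ _ hx

/-- Standard system of relations. -/
structure Std (p : ℕ) {R : Type*} [CommRing R] {mv : ℕ} (d : Fin mv → ℕ) (l : ℕ)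
    (c : Fin mv → ℕ) (h : Fin mv → MvPolynomial (Fin mv) R) : Prop where
  c_le : ∀ i, c i ≤ l
  d_le : ∀ i, c i < l → d i ≤ c i
  h_mem : ∀ i, c i < l → h i ∈ TW p R d (c i) {j | c i < c j}

/-- relation ideal -/
noncomputable def KK (p : ℕ) {R : Type*} [CommRing R] {mv : ℕ} (d : Fin mv → ℕ) (l : ℕ)
    (c : Fin mv → ℕ) (h : Fin mv → MvPolynomial (Fin mv) R) : Ideal (MvPolynomial (Fin mv) R) :=
  Ideal.span {g | ∃ i, c i < l ∧ g = X i ^ p ^ (c i - d i) - h i}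

lemma reduceX [Fact p.Prime] [CharP R p] {L : ℕ} {c : Fin mv → ℕ}
    {h : Fin mv → MvPolynomial (Fin mv) R} (H : Std p d L c h) (m : ℕ) :
    ∀ (n : ℕ) (i : Fin mv), L - c i ≤ n → d i ≤ m →
      (X i ^ p ^ (m - d i) : MvPolynomial (Fin mv) R) ∈
        (KK p d L c h).restrictScalars R ⊔ TW p R d m {j | m < c j ∨ c j = L} := by
  intro n
  induction n with
  | zero =>
    intro i h1 h2
    have := H.c_le i
    exact Submodule.mem_sup_right (X_mem_TW h2 (Or.inr (by omega)))
  | succ n ih =>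
    intro i h1 h2
    have hci := H.c_le i
    by_cases h3 : m < c i ∨ c i = L
    · exact Submodule.mem_sup_right (X_mem_TW h2 h3)
    push Not at h3
    have hlt : c i < L := by omega
    have hd := H.d_le i hlt
    have hg : (X i ^ p ^ (c i - d i) - h i) ∈ KK p d L c h := Ideal.subset_span ⟨i, hlt, rfl⟩
    have h4 : (X i ^ p ^ (m - d i) : MvPolynomial (Fin mv) R)
        = (X i ^ p ^ (c i - d i) - h i) ^ p ^ (m - c i) + h i ^ p ^ (m - c i) := by
      rw [sub_pow_char_pow, sub_add_cancel, ← pow_mul, ← pow_add]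
      congr 2; omega
    rw [h4]
    refine add_mem (Submodule.mem_sup_left ?_) ?_
    · exact Ideal.pow_mem_of_mem _ hg _ (pow_pos (Fact.out : p.Prime).pos _)
    · have h5 := TW_pow (m - c i) (H.h_mem i hlt)
      have h6 : c i + (m - c i) = m := by omega
      rw [h6] at h5
      revert h5
      generalize h i ^ p ^ (m - c i) = z
      intro h5
      refine (Submodule.span_le (p := (KK p d L c h).restrictScalars R ⊔ TW p R d m {j | m < c j ∨ c j = L})).2 ?_ h5
      rintro f ⟨j, h7, ⟨h8, h9⟩, rfl⟩
      have := H.c_le j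
      simp only [Set.mem_ofPred_eq] at h8
      exact ih j (by omega) h7

lemma reduce [Fact p.Prime] [CharP R p] {L : ℕ} {c : Fin mv → ℕ}
    {h : Fin mv → MvPolynomial (Fin mv) R} (H : Std p d L c h) (m : ℕ)
    {v : MvPolynomial (Fin mv) R} (hv : v ∈ FPV p R mv d m) :
    ∃ k ∈ KK p d L c h, ∃ w ∈ TW p R d m {j | m < c j ∨ c j = L}, k + w = v := by
  have : FPV p R mv d m ≤
      (KK p d L c h).restrictScalars R ⊔ TW p R d m {j | m < c j ∨ c j = L} := by
    refine Submodule.span_le.2 ?_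
    rintro f ⟨i, h1, rfl⟩
    exact reduceX H m _ i le_rfl h1
  exact Submodule.mem_sup.1 (this hv)

/-! ### triangular basis -/

/-- weight filtration -/
noncomputable def FF (R : Type*) [CommRing R] {mv : ℕ} (u : Fin mv → ℕ) (n : ℕ) :
    Submodule R (MvPolynomial (Fin mv) R) :=
  Submodule.span R {f | ∃ a : Fin mv →₀ ℕ, Finsupp.weight u a < n ∧ f = monomial a 1}

lemma FF_mono {u : Fin mv → ℕ} {n m : ℕ} (h : n ≤ m) : FF R u n ≤ FF R u m := by
  apply Submodule.span_mono
  rintro f ⟨a, h1, rfl⟩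
  exact ⟨a, h1.trans_le h, rfl⟩

lemma FF_mul {u : Fin mv → ℕ} {n m : ℕ} {f g : MvPolynomial (Fin mv) R}
    (hf : f ∈ FF R u n) (hg : g ∈ FF R u (m + 1)) : f * g ∈ FF R u (n + m) := by
  have : FF R u n * FF R u (m + 1) ≤ FF R u (n + m) := by
    unfold FF
    rw [Submodule.span_mul_span]
    apply Submodule.span_mono
    rintro _ ⟨_, ⟨a, h1, rfl⟩, _, ⟨b, h2, rfl⟩, rfl⟩
    refine ⟨a + b, ?_, ?_⟩
    · rw [map_add]; omega
    · simp [monomial_mul]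
  exact this (Submodule.mul_mem_mul hf hg)

/-- leading term predicate -/
def Lead (u : Fin mv → ℕ) (f : MvPolynomial (Fin mv) R) (a : Fin mv →₀ ℕ) : Prop :=
  f - monomial a 1 ∈ FF R u (Finsupp.weight u a)

lemma mono_mem_FF {u : Fin mv → ℕ} (a : Fin mv →₀ ℕ) :
    (monomial a 1 : MvPolynomial (Fin mv) R) ∈ FF R u (Finsupp.weight u a + 1) :=
  Submodule.subset_span ⟨a, by omega, rfl⟩

lemma Lead.mul {u : Fin mv → ℕ} {f g : MvPolynomial (Fin mv) R} {a b : Fin mv →₀ ℕ}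
    (hf : Lead u f a) (hg : Lead u g b) : Lead u (f * g) (a + b) := by
  unfold Lead at *
  have h1 : f * g - monomial (a + b) 1 = (f - monomial a 1) * (g - monomial b 1)
      + (g - monomial b 1) * monomial a 1 + (f - monomial a 1) * monomial b 1 := by
    have : (monomial (a + b) 1 : MvPolynomial (Fin mv) R) = monomial a 1 * monomial b 1 := by
      simp [monomial_mul]
    rw [this]; ring
  rw [h1, map_add]
  refine add_mem (add_mem ?_ ?_) ?_
  · exact FF_mul hf (FF_mono (by omega) hg)
  · rw [add_comm (Finsupp.weight u a)]; exact FF_mul hg (mono_mem_FF a)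
  · exact FF_mul hf (mono_mem_FF b)

lemma Lead.one {u : Fin mv → ℕ} : Lead u (1 : MvPolynomial (Fin mv) R) 0 := by
  unfold Lead
  have : (monomial 0 1 : MvPolynomial (Fin mv) R) = 1 := by simp
  rw [this, sub_self]; exact zero_mem _

lemma Lead.pow {u : Fin mv → ℕ} {f : MvPolynomial (Fin mv) R} {a : Fin mv →₀ ℕ}
    (hf : Lead u f a) (n : ℕ) : Lead u (f ^ n) (n • a) := by
  induction n with
  | zero => simpa using Lead.one
  | succ n ih => rw [pow_succ, succ_nsmul]; exact ih.mul hf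

lemma Lead.prod {u : Fin mv → ℕ} {f : Fin mv → MvPolynomial (Fin mv) R}
    {a : Fin mv → Fin mv →₀ ℕ} (hf : ∀ i, Lead u (f i) (a i)) (s : Finset (Fin mv)) :
    Lead u (∏ i ∈ s, f i) (∑ i ∈ s, a i) := by
  classical
  induction s using Finset.induction_on with
  | empty => simpa using Lead.one
  | insert i s hi ih => rw [Finset.prod_insert hi, Finset.sum_insert hi]; exact (hf i).mul ih

lemma exists_FF {u : Fin mv → ℕ} (f : MvPolynomial (Fin mv) R) : ∃ n, f ∈ FF R u n := by
  induction f using MvPolynomial.induction_on' with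
  | monomial a r =>
    refine ⟨Finsupp.weight u a + 1, ?_⟩
    · have := Submodule.smul_mem _ r (mono_mem_FF (R := R) (u := u) a)
      rwa [smul_monomial, smul_eq_mul, mul_one] at this
  | add f g hf hg =>
    obtain ⟨n, hn⟩ := hf
    obtain ⟨m, hm⟩ := hg
    exact ⟨max n m, add_mem (FF_mono (le_max_left _ _) hn) (FF_mono (le_max_right _ _) hm)⟩

lemma bij_of_lead {u : Fin mv → ℕ} (T : MvPolynomial (Fin mv) R →ₗ[R] MvPolynomial (Fin mv) R)
    (hT : ∀ a, Lead u (T (monomial a 1)) a) : Function.Bijective T := by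
  have key : ∀ n f, f ∈ FF R u (n + 1) → T f - f ∈ FF R u n := by
    intro n f hf
    have : FF R u (n + 1) ≤ (FF R u n).comap (T - LinearMap.id) := by
      refine Submodule.span_le.2 ?_
      rintro _ ⟨a, ha, rfl⟩
      exact FF_mono (by omega) (hT a)
    exact this hf
  have h0 : ∀ f, f ∈ FF R u 0 → f = 0 := by
    intro f hf
    have : FF R u 0 = ⊥ := by
      unfold FF; rw [Submodule.span_eq_bot]
      rintro _ ⟨a, ha, rfl⟩; omega
    rwa [this, Submodule.mem_bot] at hf
  constructor
  · rw [← LinearMap.ker_eq_bot, LinearMap.ker_eq_bot']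
    intro f hf
    obtain ⟨n, hn⟩ := exists_FF (u := u) f
    induction n with
    | zero => exact h0 f hn
    | succ n ih =>
      have := key n f hn
      rw [hf, zero_sub, neg_mem_iff] at this
      exact ih this
  · intro f
    obtain ⟨n, hn⟩ := exists_FF (u := u) f
    induction n generalizing f with
    | zero => exact ⟨0, by rw [h0 f hn, map_zero]⟩
    | succ n ih =>
      obtain ⟨g, hg⟩ := ih _ (key n f hn)
      exact ⟨f - g, by rw [map_sub, hg]; ring⟩

lemma idealspan_le {s : Set (MvPolynomial (Fin mv) R)} {N : Submodule R (MvPolynomial (Fin mv) R)}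
    (h : ∀ g ∈ s, ∀ a : Fin mv →₀ ℕ, monomial a 1 * g ∈ N) {x : MvPolynomial (Fin mv) R}
    (hx : x ∈ Ideal.span s) : x ∈ N := by
  have h' : ∀ g ∈ s, ∀ f : MvPolynomial (Fin mv) R, f * g ∈ N := by
    intro g hg f
    induction f using MvPolynomial.induction_on' with
    | monomial a r =>
      have := Submodule.smul_mem N r (h g hg a)
      rwa [← smul_mul_assoc, smul_monomial, smul_eq_mul, mul_one] at this
    | add f f' hf hf' => rw [add_mul]; exact add_mem hf hf'
  have : ∀ f : MvPolynomial (Fin mv) R, f * x ∈ N := by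
    induction hx using Submodule.span_induction with
    | mem x hx => exact h' x hx
    | zero => simp
    | add x y _ _ hx hy => intro f; rw [mul_add]; exact add_mem (hx f) (hy f)
    | smul r x _ hx => intro f; rw [smul_eq_mul, ← mul_assoc]; exact hx _
  simpa using this 1

/-- span of monomials satisfying a predicate -/
noncomputable def MS (R : Type*) [CommRing R] {mv : ℕ} (D : (Fin mv →₀ ℕ) → Prop) :
    Submodule R (MvPolynomial (Fin mv) R) :=
  Submodule.span R {f | ∃ a, D a ∧ f = monomial a 1}

open Classical in
/-- projection onto the monomials satisfying a predicate -/
noncomputable def pr (R : Type*) [CommRing R] {mv : ℕ} (D : (Fin mv →₀ ℕ) → Prop) :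
    MvPolynomial (Fin mv) R →ₗ[R] MvPolynomial (Fin mv) R :=
  (basisMonomials (Fin mv) R).constr R (fun a => if D a then monomial a 1 else 0)

lemma pr_pos {D : (Fin mv →₀ ℕ) → Prop} {a} (h : D a) :
    pr R D (monomial a 1) = monomial a 1 := by
  have := (basisMonomials (Fin mv) R).constr_basis R (fun a => open Classical in if D a then monomial a (1 : R) else 0) a
  rw [coe_basisMonomials] at this
  rw [pr, this, if_pos h]

lemma pr_neg {D : (Fin mv →₀ ℕ) → Prop} {a} (h : ¬ D a) :
    pr R D (monomial a 1) = 0 := by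
  have := (basisMonomials (Fin mv) R).constr_basis R (fun a => open Classical in if D a then monomial a (1 : R) else 0) a
  rw [coe_basisMonomials] at this
  rw [pr, this, if_neg h]

lemma mono_ind {N : Submodule R (MvPolynomial (Fin mv) R)} (h : ∀ a, monomial a 1 ∈ N) (f) :
    f ∈ N := by
  induction f using MvPolynomial.induction_on' with
  | monomial a r =>
    have := Submodule.smul_mem N r (h a)
    rwa [smul_monomial, smul_eq_mul, mul_one] at this
  | add f f' hf hf' => exact add_mem hf hf'

lemma pr_MS {D E : (Fin mv →₀ ℕ) → Prop} (h : ∀ a, D a → ¬ E a) {f} (hf : f ∈ MS R D) :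
    pr R E f = 0 := by
  have : MS R D ≤ LinearMap.ker (pr R E) := by
    refine Submodule.span_le.2 ?_
    rintro _ ⟨a, ha, rfl⟩
    exact pr_neg (h a ha)
  exact this hf

lemma sub_pr_mem (D : (Fin mv →₀ ℕ) → Prop) (f) : f - pr R D f ∈ MS R (fun a => ¬ D a) := by
  have : ∀ f, f ∈ (MS R (fun a => ¬ D a)).comap (LinearMap.id - pr R D) := by
    apply mono_ind
    intro a
    by_cases h : D a
    · simp [pr_pos h]
    · simp only [Submodule.mem_comap, LinearMap.sub_apply, LinearMap.id_apply, pr_neg h, sub_zero]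
      exact Submodule.subset_span ⟨a, h, rfl⟩
  exact this f

/-- reduced exponents -/
def BB (p : ℕ) {mv : ℕ} (d : Fin mv → ℕ) (l : ℕ) (c : Fin mv → ℕ) (a : Fin mv →₀ ℕ) : Prop :=
  ∀ i, c i < l → a i < p ^ (c i - d i)

lemma exists_T [Fact p.Prime] {l : ℕ} {c : Fin mv → ℕ}
    {h : Fin mv → MvPolynomial (Fin mv) R} (H : Std p d l c h) :
    ∃ T : MvPolynomial (Fin mv) R ≃ₗ[R] MvPolynomial (Fin mv) R,
      (∀ a, BB p d l c a → T (monomial a 1) = monomial a 1) ∧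
      (∀ f, f ∈ MS R (fun a => ¬ BB p d l c a) → T f ∈ KK p d l c h) ∧
      (∀ f, f ∈ KK p d l c h → T.symm f ∈ MS R (fun a => ¬ BB p d l c a)) := by
  have hp : 0 < p := (Fact.out : p.Prime).pos
  let u : Fin mv → ℕ := fun i => p ^ d i * (l - c i)
  let q : Fin mv → ℕ := fun i => if c i < l then p ^ (c i - d i) else 1
  let hh : Fin mv → MvPolynomial (Fin mv) R := fun i => if c i < l then h i else 0
  let gg : Fin mv → MvPolynomial (Fin mv) R := fun i => X i ^ q i - hh i
  have hq : ∀ i, 0 < q i := by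
    intro i; simp only [q]; split_ifs <;> positivity
  have hX : ∀ i, Lead u (X i : MvPolynomial (Fin mv) R) (Finsupp.single i 1) := by
    intro i; unfold Lead; rw [X, sub_self]; exact zero_mem _
  have hgg : ∀ i, Lead u (gg i) (q i • Finsupp.single i 1) := by
    intro i
    have h1 : gg i - monomial (q i • Finsupp.single i 1) 1 = - hh i := by
      simp only [gg]
      rw [X, monomial_pow, one_pow]; ring
    unfold Lead
    rw [h1, neg_mem_iff]
    by_cases hc : c i < l
    · simp only [hh, q, if_pos hc]
      have hd := H.d_le i hc
      refine (Submodule.span_le (p := FF R u _)).2 ?_ (H.h_mem i hc)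
      rintro _ ⟨j, h2, h3, rfl⟩
      simp only [Set.mem_ofPred_eq] at h3
      refine Submodule.subset_span ⟨p ^ (c i - d j) • Finsupp.single j 1, ?_, ?_⟩
      · simp only [map_nsmul, Finsupp.weight_single, u, smul_eq_mul, one_mul]
        rw [← mul_assoc, ← mul_assoc, ← pow_add, ← pow_add, Nat.sub_add_cancel h2,
          Nat.sub_add_cancel hd]
        exact Nat.mul_lt_mul_of_pos_left (by omega) (by positivity)
      · rw [X, monomial_pow, one_pow]
    · simp only [hh, if_neg hc]; exact zero_mem _
  let P : (Fin mv →₀ ℕ) → MvPolynomial (Fin mv) R :=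
    fun a => ∏ i, (X i ^ (a i % q i) * gg i ^ (a i / q i))
  have hP : ∀ a, Lead u (P a) a := by
    intro a
    have h1 := Lead.prod (u := u) (f := fun i => X i ^ (a i % q i) * gg i ^ (a i / q i))
      (a := fun i => (a i % q i) • Finsupp.single i 1 + (a i / q i) • (q i • Finsupp.single i 1))
      (fun i => ((hX i).pow _).mul ((hgg i).pow _)) Finset.univ
    have h2 : ∑ i, ((a i % q i) • Finsupp.single i 1 + (a i / q i) • (q i • Finsupp.single i 1))
        = a := by
      have : ∀ i, ((a i % q i) • Finsupp.single i 1 + (a i / q i) • (q i • Finsupp.single i 1))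
        = Finsupp.single i (a i) := by
        intro i
        rw [smul_smul, ← add_smul, Finsupp.smul_single, smul_eq_mul, mul_one, Nat.mod_add_div']
      simp only [this]
      exact Finsupp.univ_sum_single a
    rw [h2] at h1
    exact h1
  let T0 : MvPolynomial (Fin mv) R →ₗ[R] MvPolynomial (Fin mv) R :=
    (basisMonomials (Fin mv) R).constr R P
  have hT0 : ∀ a, T0 (monomial a 1) = P a := by
    intro a
    have := (basisMonomials (Fin mv) R).constr_basis R P a
    rwa [coe_basisMonomials] at this
  have hbij := bij_of_lead (u := u) T0 (fun a => by rw [hT0]; exact hP a)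
  let T := LinearEquiv.ofBijective T0 hbij
  have hT : ∀ a, T (monomial a 1) = P a := hT0
  refine ⟨T, ?_, ?_, ?_⟩
  · intro a ha
    rw [hT, monomial_eq, C_1, one_mul, Finsupp.prod_fintype _ _ (by simp)]
    refine Finset.prod_congr rfl fun i _ => ?_
    by_cases hc : c i < l
    · have := ha i hc
      simp only [q, if_pos hc, Nat.mod_eq_of_lt this, Nat.div_eq_of_lt this, pow_zero, mul_one]
    · simp only [gg, hh, q, if_neg hc, Nat.mod_one, Nat.div_one, pow_zero, one_mul, pow_one, sub_zero]
  · intro f hf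
    have : MS R (fun a => ¬ BB p d l c a) ≤ ((KK p d l c h).restrictScalars R).comap T.toLinearMap := by
      refine Submodule.span_le.2 ?_
      rintro _ ⟨a, ha, rfl⟩
      show T (monomial a 1) ∈ KK p d l c h
      rw [hT]
      unfold BB at ha
      push Not at ha
      obtain ⟨i, hc, hi⟩ := ha
      have hqi : q i = p ^ (c i - d i) := by simp only [q, if_pos hc]
      rw [← hqi] at hi
      have hg : gg i ∈ KK p d l c h := by
        refine Ideal.subset_span ⟨i, hc, ?_⟩
        simp only [gg, hqi, hh, if_pos hc]
      have h1 : gg i ∣ P a := by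
        refine dvd_trans ?_ (Finset.dvd_prod_of_mem _ (Finset.mem_univ i))
        refine Dvd.dvd.mul_left (dvd_pow_self _ ?_) _
        exact (Nat.div_pos hi (hq i)).ne'
      exact Ideal.mem_of_dvd _ h1 hg
    exact this hf
  · intro f hf
    have : f ∈ (MS R (fun a => ¬ BB p d l c a)).map T.toLinearMap := by
      let N := (MS R (fun a => ¬ BB p d l c a)).map T.toLinearMap
      have h1 : ∀ i, c i < l → ∀ f, f * gg i ∈ N := by
        intro i hc f
        obtain ⟨f, rfl⟩ := T.surjective f
        have h2 : ∀ f, f ∈ N.comap ((LinearMap.mulRight R (gg i)).comp T.toLinearMap) := by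
          apply mono_ind
          intro a
          show T (monomial a 1) * gg i ∈ N
          have h3 : T (monomial a 1) * gg i = T (monomial (a + Finsupp.single i (q i)) 1) := by
            rw [hT, hT]
            simp only [P]
            rw [← Finset.mul_prod_erase _ _ (Finset.mem_univ i),
              ← Finset.mul_prod_erase Finset.univ (fun j => X j ^ ((a + Finsupp.single i (q i)) j % q j) * gg j ^ ((a + Finsupp.single i (q i)) j / q j)) (Finset.mem_univ i)]
            have h4 : ∏ x ∈ Finset.univ.erase i, X x ^ ((a + Finsupp.single i (q i)) x % q x) * gg x ^ ((a + Finsupp.single i (q i)) x / q x) = ∏ x ∈ Finset.univ.erase i, X x ^ (a x % q x) * gg x ^ (a x / q x) := by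
              refine Finset.prod_congr rfl fun j hj => ?_
              have : (a + Finsupp.single i (q i)) j = a j := by
                simp [Finsupp.single_eq_of_ne (Finset.ne_of_mem_erase hj)]
              rw [this]
            rw [h4]
            have h5 : (a + Finsupp.single i (q i)) i = a i + q i := by simp
            rw [h5, Nat.add_mod_right, Nat.add_div_right _ (hq i), pow_succ]
            ring
          rw [h3]
          refine ⟨_, Submodule.subset_span ⟨_, ?_, rfl⟩, rfl⟩
          intro hB
          have := hB i hc
          simp only [q, if_pos hc, Finsupp.add_apply, Finsupp.single_eq_same] at this
          omega
        exact h2 f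
      refine idealspan_le ?_ hf
      rintro g ⟨i, hc, rfl⟩ a
      have := h1 i hc (monomial a 1)
      simpa only [gg, q, hh, if_pos hc] using this
    obtain ⟨g, hg, rfl⟩ := this
    simpa using hg

universe u

lemma flat_of_proj {R S : Type*} [CommRing R] [AddCommGroup S] [Module R S] (N V : Submodule R S)
    (θ : S →ₗ[R] S) (h1 : ∀ f, θ f ∈ V) (h2 : ∀ f ∈ N, θ f ∈ N) (h3 : ∀ f ∈ V, f - θ f ∈ N)
    (hflat : Module.Flat R (S ⧸ N)) : Module.Flat R (V.map N.mkQ) := by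
  let r : S →ₗ[R] V.map N.mkQ :=
    LinearMap.codRestrict (V.map N.mkQ) (N.mkQ ∘ₗ θ) (fun f => ⟨_, h1 f, rfl⟩)
  have hr : N ≤ LinearMap.ker r := by
    intro f hf
    rw [LinearMap.mem_ker, ← Subtype.coe_inj]
    exact (Submodule.Quotient.mk_eq_zero N).2 (h2 f hf)
  refine Module.Flat.of_retract (V.map N.mkQ).subtype (Submodule.liftQ _ r hr) ?_
  ext ⟨x, f, hf, rfl⟩
  exact ((Submodule.Quotient.eq N).2 (h3 f hf)).symm

lemma flat_quot_KK [Fact p.Prime] {l : ℕ} {c : Fin mv → ℕ}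
    {h : Fin mv → MvPolynomial (Fin mv) R} (H : Std p d l c h) :
    Module.Flat R (MvPolynomial (Fin mv) R ⧸ (KK p d l c h).restrictScalars R) := by
  obtain ⟨T, h1, h2, h3⟩ := exists_T H
  let ν : MvPolynomial (Fin mv) R →ₗ[R] MvPolynomial (Fin mv) R :=
    T.toLinearMap ∘ₗ pr R (BB p d l c) ∘ₗ T.symm.toLinearMap
  have hν : (KK p d l c h).restrictScalars R ≤ LinearMap.ker ν := by
    intro f hf
    have := pr_MS (E := BB p d l c) (fun a ha => ha) (h3 f hf)
    simp [ν, this]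
  refine Module.Flat.of_retract (Submodule.liftQ _ ν hν) (Submodule.mkQ _) ?_
  apply Submodule.linearMap_qext
  refine LinearMap.ext fun f => ?_
  refine Eq.symm ((Submodule.Quotient.eq ((KK p d l c h).restrictScalars R)).2 ?_)
  show f - ν f ∈ KK p d l c h
  have := h2 _ (sub_pr_mem (BB p d l c) (T.symm f))
  simpa [ν] using this

lemma FPV_homog {m : ℕ} {g : MvPolynomial (Fin mv) R} (hg : g ∈ FPV p R mv d m) :
    IsWeightedHomogeneous (fun i => p ^ d i) g (p ^ m) := by
  have : FPV p R mv d m ≤ weightedHomogeneousSubmodule R (fun i => p ^ d i) (p ^ m) := by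
    refine Submodule.span_le.2 ?_
    rintro _ ⟨i, h1, rfl⟩
    have h2 := (isWeightedHomogeneous_X R (fun i => p ^ d i) i).pow (p ^ (m - d i))
    rw [smul_eq_mul, ← pow_add, Nat.sub_add_cancel h1] at h2
    exact h2
  exact this hg

lemma exists_pi [Fact p.Prime] [CharP R p] {l : ℕ} {c : Fin mv → ℕ}
    {h : Fin mv → MvPolynomial (Fin mv) R} (H : Std p d l c h) :
    ∃ π : MvPolynomial (Fin mv) R →ₗ[R] MvPolynomial (Fin mv) R,
      (∀ f ∈ KK p d l c h, π f = 0) ∧ (∀ f ∈ FPV p R mv d l, f - π f ∈ KK p d l c h) ∧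
      (∀ f, π f ∈ FPV p R mv d l) := by
  have hp : p.Prime := Fact.out
  obtain ⟨T, h1, h2, h3⟩ := exists_T H
  let Z : (Fin mv →₀ ℕ) → Prop :=
    fun a => ∃ j, d j ≤ l ∧ c j = l ∧ a = Finsupp.single j (p ^ (l - d j))
  have hZB : ∀ a, Z a → BB p d l c a := by
    rintro _ ⟨j, hj1, hj2, rfl⟩ i hi
    have : i ≠ j := by rintro rfl; omega
    rw [Finsupp.single_eq_of_ne this]
    exact pow_pos hp.pos _
  obtain ⟨π, hπ⟩ : ∃ π : MvPolynomial (Fin mv) R →ₗ[R] MvPolynomial (Fin mv) R,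
      ∀ f, π f = pr R Z (T.symm f) := ⟨pr R Z ∘ₗ T.symm.toLinearMap, fun _ => rfl⟩
  have hπK : ∀ f ∈ KK p d l c h, π f = 0 := by
    intro f hf
    rw [hπ]
    exact pr_MS (fun a ha hz => ha (hZB a hz)) (h3 f hf)
  have hπW : ∀ f ∈ TW p R d l {j | l < c j ∨ c j = l}, π f = f := by
    intro f hf
    induction hf using Submodule.span_induction with
    | mem x hx =>
      obtain ⟨j, h4, h5, rfl⟩ := hx
      have h6 : c j = l := by
        have := H.c_le j
        rcases h5 with h5 | h5 <;> omega
      have hz : Z (Finsupp.single j (p ^ (l - d j))) := ⟨j, h4, h6, rfl⟩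
      rw [X_pow_eq_monomial]
      have h7 := h1 _ (hZB _ hz)
      have h8 : T.symm (monomial (Finsupp.single j (p ^ (l - d j))) 1) = monomial (Finsupp.single j (p ^ (l - d j))) (1 : R) := by
        rw [LinearEquiv.symm_apply_eq]; exact h7.symm
      rw [hπ, h8, pr_pos hz]
    | zero => exact map_zero _
    | add x y _ _ hx hy => rw [map_add, hx, hy]
    | smul a x _ hx => rw [map_smul, hx]
  have hπV : ∀ f ∈ FPV p R mv d l, f - π f ∈ KK p d l c h := by
    intro f hf
    obtain ⟨k, hk, w, hw, rfl⟩ := reduce H l hf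
    rw [map_add, hπK k hk, hπW w hw]
    simpa using hk
  have hprF : ∀ f, pr R Z f ∈ FPV p R mv d l := by
    have : ∀ f, f ∈ (FPV p R mv d l).comap (pr R Z) := by
      apply mono_ind
      intro a
      by_cases hz : Z a
      · rw [Submodule.mem_comap, pr_pos hz]
        obtain ⟨j, h4, h6, rfl⟩ := hz
        rw [← X_pow_eq_monomial]
        exact Submodule.subset_span ⟨j, h4, rfl⟩
      · rw [Submodule.mem_comap, pr_neg hz]; exact zero_mem _
    exact this
  exact ⟨π, hπK, hπV, fun f => by rw [hπ]; exact hprF _⟩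

lemma flat_FPV_step [Fact p.Prime] [CharP R p] {l : ℕ} {c : Fin mv → ℕ}
    {h : Fin mv → MvPolynomial (Fin mv) R} (H : Std p d l c h)
    (I : Ideal (MvPolynomial (Fin mv) R)) (s : Set (MvPolynomial (Fin mv) R))
    (hs : ∀ f ∈ s, ∃ l : ℕ, f ∈ FPV p R mv d l) (hI : I = Ideal.span s)
    (hKI : KK p d l c h ≤ I)
    (hK : ∀ m < l, ∀ v ∈ FPV p R mv d m, v ∈ I → v ∈ KK p d l c h)
    (hflat : Module.Flat R (MvPolynomial (Fin mv) R ⧸ I.restrictScalars R)) :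
    Module.Flat R ((FPV p R mv d l).map (I.restrictScalars R).mkQ) := by
  have hp : p.Prime := Fact.out
  obtain ⟨π, hπK, hπV, hprF⟩ := exists_pi H
  let cp : MvPolynomial (Fin mv) R →ₗ[R] MvPolynomial (Fin mv) R :=
    weightedHomogeneousComponent (fun i => p ^ d i) (p ^ l)
  refine flat_of_proj (I.restrictScalars R) (FPV p R mv d l) (π ∘ₗ cp) (fun f => hprF _) ?_ ?_ hflat
  swap
  · intro f hf
    have h4 : cp f = f := (FPV_homog hf).weightedHomogeneousComponent_same
    show f - π (cp f) ∈ I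
    rw [h4]
    exact hKI (hπV f hf)
  · intro f hf
    have hf' : f ∈ Ideal.span s := hI ▸ hf
    refine idealspan_le (N := (I.restrictScalars R).comap (π ∘ₗ cp)) ?_ hf'
    intro g hg a
    have hgI : g ∈ I := hI ▸ Ideal.subset_span hg
    show π (cp (monomial a 1 * g)) ∈ I
    obtain ⟨m, hm⟩ := hs g hg
    have hh := (isWeightedHomogeneous_monomial (fun i => p ^ d i) a (1 : R) rfl).mul
      (FPV_homog hm)
    by_cases he : Finsupp.weight (fun i => p ^ d i) a + p ^ m = p ^ l
    · rw [he] at hh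
      have h4 : cp (monomial a 1 * g) = monomial a 1 * g := hh.weightedHomogeneousComponent_same
      rw [h4]
      have hml : m ≤ l := by
        rw [← Nat.pow_le_pow_iff_right hp.one_lt]; omega
      rcases hml.lt_or_eq with hlt | rfl
      · rw [hπK]
        · exact zero_mem _
        · exact Ideal.mul_mem_left _ _ (hK m hlt g hm hgI)
      · have h5 : Finsupp.weight (fun i => p ^ d i) a = 0 := by omega
        have h6 : a = 0 := by
          ext i
          have := Finsupp.le_weight (fun i => p ^ d i) (s := i) (pow_pos hp.pos _).ne' a
          simp only [Finsupp.coe_zero, Pi.zero_apply]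
          omega
        subst h6
        have h7 : (monomial 0 1 : MvPolynomial (Fin mv) R) = 1 := by simp
        rw [h7, one_mul]
        have := I.sub_mem hgI (hKI (hπV g hm))
        simpa using this
    · have h4 : cp (monomial a 1 * g) = 0 := hh.weightedHomogeneousComponent_ne _ (Ne.symm he)
      rw [h4, map_zero]; exact zero_mem _

end

lemma step {p : ℕ} {R : Type u} [CommRing R] {mv : ℕ} {d : Fin mv → ℕ}
    [Fact p.Prime] [CharP R p] [IsLocalRing R] {l : ℕ} {c : Fin mv → ℕ}
    {h : Fin mv → MvPolynomial (Fin mv) R} (H : Std p d l c h)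
    (I : Ideal (MvPolynomial (Fin mv) R))
    (hKI : KK p d l c h ≤ I)
    (hK : ∀ m < l, ∀ v ∈ FPV p R mv d m, v ∈ I → v ∈ KK p d l c h)
    (hflat : Module.Flat R ((FPV p R mv d l).map (I.restrictScalars R).mkQ)) :
    ∃ c' h', Std (R := R) p d (l + 1) c' h' ∧ KK p d (l + 1) c' h' ≤ I ∧
      ∀ m < l + 1, ∀ v ∈ FPV p R mv d m, v ∈ I → v ∈ KK p d (l + 1) c' h' := by
  classical
  let Q := (I.restrictScalars R).mkQ
  let M := (FPV p R mv d l).map Q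
  have hfin : Module.Finite R M := by
    have : (FPV p R mv d l).FG := by
      refine Submodule.fg_span ?_
      refine (Set.finite_range (fun i : Fin mv => (X i ^ p ^ (l - d i) : MvPolynomial (Fin mv) R))).subset ?_
      rintro _ ⟨i, _, rfl⟩
      exact ⟨i, rfl⟩
    exact Module.Finite.iff_fg.2 (this.map _)
  have hflat' : Module.Flat R M := hflat
  have hfree : Module.Free R M := Module.free_of_flat_of_isLocalRing
  have hfp : Module.FinitePresentation R M := Module.finitePresentation_of_projective R M
  let Y := {j : Fin mv // d j ≤ l ∧ c j = l}
  let v : ULift.{u} Y → M := fun j =>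
    ⟨Q (X j.down.1 ^ p ^ (l - d j.down.1)), _, Submodule.subset_span ⟨_, j.down.2.1, rfl⟩, rfl⟩
  have hv : Submodule.span R (Set.range v) = ⊤ := by
    rw [eq_top_iff]
    rintro ⟨x, f, hf, rfl⟩ -
    obtain ⟨k, hk, w, hw, rfl⟩ := reduce H l hf
    have h1 : TW p R d l {j | l < c j ∨ c j = l} ≤
        ((Submodule.span R (Set.range v)).map M.subtype).comap Q := by
      refine Submodule.span_le.2 ?_
      rintro _ ⟨j, h4, h5, rfl⟩
      have h6 : c j = l := by
        have := H.c_le j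
        rcases h5 with h5 | h5 <;> omega
      exact ⟨v ⟨⟨j, h4, h6⟩⟩, Submodule.subset_span ⟨_, rfl⟩, rfl⟩
    obtain ⟨y, hy, hyw⟩ := h1 hw
    have h2 : Q k = 0 := (Submodule.Quotient.mk_eq_zero _).2 (hKI hk)
    refine (congrArg (· ∈ Submodule.span R (Set.range v)) (Subtype.ext ?_)).mpr hy
    show Q (k + w) = M.subtype y
    rw [hyw, map_add, h2, zero_add]
  obtain ⟨κ, a, b, hb⟩ := Module.exists_basis_of_span_of_flat v hv
  let e : κ → Fin mv := fun k => (a k).down.1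
  have he : ∀ k, d (e k) ≤ l ∧ c (e k) = l := fun k => (a k).down.2
  let Y' : Set (Fin mv) := Set.range e
  have hlift : ∀ f ∈ FPV p R mv d l, ∃ w ∈ TW p R d l Y', f - w ∈ I := by
    intro f hf
    have h1 : (⊤ : Submodule R M) ≤ ((TW p R d l Y').map Q).comap M.subtype := by
      rw [← b.span_eq]
      refine Submodule.span_le.2 ?_
      rintro _ ⟨k, rfl⟩
      rw [hb]
      exact ⟨X (e k) ^ p ^ (l - d (e k)), X_mem_TW (he k).1 ⟨k, rfl⟩, rfl⟩
    obtain ⟨w, hw, hw'⟩ := h1 (Submodule.mem_top (x := (⟨Q f, f, hf, rfl⟩ : M)))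
    exact ⟨w, hw, (Submodule.Quotient.eq (I.restrictScalars R)).1 hw'.symm⟩
  have hindep : ∀ w ∈ TW p R d l Y', w ∈ I → w = 0 := by
    intro w hw hwI
    have h1 : TW p R d l Y' ≤ Submodule.span R (Set.range fun k => (X (e k) ^ p ^ (l - d (e k)) : MvPolynomial (Fin mv) R)) := by
      refine Submodule.span_mono ?_
      rintro _ ⟨_, _, ⟨k, rfl⟩, rfl⟩
      exact ⟨k, rfl⟩
    have h2 := h1 hw
    rw [← Finsupp.range_linearCombination] at h2
    obtain ⟨t, rfl⟩ := h2
    have h3 : Finsupp.linearCombination R b t = 0 := by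
      rw [← Subtype.coe_inj]
      have h4 : M.subtype (Finsupp.linearCombination R b t) =
          Q (Finsupp.linearCombination R (fun k => (X (e k) ^ p ^ (l - d (e k)) : MvPolynomial (Fin mv) R)) t) := by
        rw [Finsupp.apply_linearCombination, Finsupp.apply_linearCombination]
        congr 2
        ext1 k
        simp only [Function.comp_apply, hb]
        rfl
      refine h4.trans ?_
      exact (Submodule.Quotient.mk_eq_zero (I.restrictScalars R)).2 hwI
    have h5 : t = 0 := by
      have := b.linearIndependent
      rw [linearIndependent_iff] at this
      exact this t h3
    rw [h5, map_zero]
  have hch : ∀ i, ∃ w, d i ≤ l → w ∈ TW p R d l Y' ∧ X i ^ p ^ (l - d i) - w ∈ I := by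
    intro i
    by_cases hi : d i ≤ l
    · obtain ⟨w, hw⟩ := hlift _ (Submodule.subset_span ⟨i, hi, rfl⟩)
      exact ⟨w, fun _ => hw⟩
    · exact ⟨0, fun h => absurd h hi⟩
  choose w hw using hch
  let c' : Fin mv → ℕ := fun i => if c i < l then c i else if d i ≤ l ∧ i ∉ Y' then l else l + 1
  let h' : Fin mv → MvPolynomial (Fin mv) R := fun i => if c i < l then h i else w i
  have hc1 : ∀ i, c i < l → c' i = c i := fun i hi => by simp only [c', if_pos hi]
  have hh1 : ∀ i, c i < l → h' i = h i := fun i hi => by simp only [h', if_pos hi]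
  have hh2 : ∀ i, ¬ c i < l → h' i = w i := fun i hi => by simp only [h', if_neg hi]
  have hcc : ∀ i, c i ≤ c' i := by
    intro i
    have := H.c_le i
    simp only [c']; split_ifs <;> omega
  have hc2 : ∀ i, ¬ c i < l → c' i < l + 1 → d i ≤ l ∧ c' i = l := by
    intro i h1 h2
    simp only [c', if_neg h1] at h2 ⊢
    split_ifs at h2 ⊢ with h3
    · exact ⟨h3.1, rfl⟩
    · omega
  have hc3 : ∀ i ∈ Y', c' i = l + 1 := by
    rintro _ ⟨k, rfl⟩
    have h1 : ¬ c (e k) < l := by rw [(he k).2]; omega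
    have h2 : ¬ (d (e k) ≤ l ∧ e k ∉ Y') := fun hx => hx.2 ⟨k, rfl⟩
    simp only [c', if_neg h1, if_neg h2]
  have hc4 : ∀ i, d i ≤ l → l < c' i → i ∈ Y' := by
    intro i h1 h2
    by_contra h3
    simp only [c', h1, h3, not_false_iff, and_self, if_true] at h2
    split_ifs at h2 <;> omega
  have hS : Std p d (l + 1) c' h' := by
    refine ⟨?_, ?_, ?_⟩
    · intro i
      have := H.c_le i
      simp only [c']; split_ifs <;> omega
    · intro i hi
      by_cases h1 : c i < l
      · rw [hc1 i h1]; exact H.d_le i h1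
      · have := hc2 i h1 hi
        omega
    · intro i hi
      by_cases h1 : c i < l
      · rw [hc1 i h1, hh1 i h1]
        refine TW_mono ?_ (H.h_mem i h1)
        intro j _ hj
        exact lt_of_lt_of_le hj (hcc j)
      · have h2 := hc2 i h1 hi
        rw [h2.2, hh2 i h1]
        refine TW_mono ?_ (hw i h2.1).1
        intro j _ hj
        show l < c' j
        rw [hc3 j hj]; omega
  have hKI' : KK p d (l + 1) c' h' ≤ I := by
    refine Ideal.span_le.2 ?_
    rintro _ ⟨i, hi, rfl⟩
    by_cases h1 : c i < l
    · rw [hc1 i h1, hh1 i h1]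
      exact hKI (Ideal.subset_span ⟨i, h1, rfl⟩)
    · have h2 := hc2 i h1 hi
      rw [h2.2, hh2 i h1]
      exact (hw i h2.1).2
  refine ⟨c', h', hS, hKI', ?_⟩
  intro m hm x hx hxI
  rcases (Nat.lt_succ_iff.1 hm).lt_or_eq with hlt | rfl
  · have : KK p d l c h ≤ KK p d (l + 1) c' h' := by
      refine Ideal.span_mono ?_
      rintro _ ⟨i, hi, rfl⟩
      exact ⟨i, by rw [hc1 i hi]; omega, by rw [hc1 i hi, hh1 i hi]⟩
    exact this (hK m hlt x hx hxI)
  · obtain ⟨k, hk, y, hy, rfl⟩ := reduce hS m hx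
    have hy' : y ∈ TW p R d m Y' := by
      refine TW_mono ?_ hy
      intro j hj1 hj2
      apply hc4 j hj1
      rcases hj2 with hj2 | hj2
      · exact hj2
      · rw [hj2]; omega
    have hyI : y ∈ I := by
      have := I.sub_mem hxI (hKI' hk)
      simpa using this
    rw [hindep y hy' hyI, add_zero]
    exact hk

theorem local_iff {p : ℕ} {R : Type*} [CommRing R] {mv : ℕ} {d : Fin mv → ℕ}
    [Fact p.Prime] [CharP R p] [IsLocalRing R] (n : ℕ)
    (I : Ideal (MvPolynomial (Fin mv) R)) (s : Set (MvPolynomial (Fin mv) R))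
    (hs : ∀ f ∈ s, ∃ l : ℕ, l ≤ n ∧ f ∈ FPV p R mv d l) (hI : I = Ideal.span s) :
    Module.Flat R (MvPolynomial (Fin mv) R ⧸ I.restrictScalars R) ↔
      ∀ m ≤ n, Module.Flat R ((FPV p R mv d m).map (I.restrictScalars R).mkQ) := by
  have base : ∃ c h, Std (R := R) p d 0 c h ∧ KK p d 0 c h ≤ I ∧
      ∀ m < 0, ∀ v ∈ FPV p R mv d m, v ∈ I → v ∈ KK p d 0 c h := by
    refine ⟨0, 0, ⟨by simp, by simp, by simp⟩, ?_, by simp⟩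
    refine Ideal.span_le.2 ?_
    rintro _ ⟨i, hi, rfl⟩
    exact absurd hi (by simp)
  constructor
  · intro hflat
    have key : ∀ l, ∃ c h, Std (R := R) p d l c h ∧ KK p d l c h ≤ I ∧
      ∀ m < l, ∀ v ∈ FPV p R mv d m, v ∈ I → v ∈ KK p d l c h := by
      intro l
      induction l with
      | zero => exact base
      | succ l ih =>
        obtain ⟨c, h, H, hKI, hK⟩ := ih
        exact step H I hKI hK (flat_FPV_step H I s
          (fun f hf => (hs f hf).imp fun _ h => h.2) hI hKI hK hflat)
    intro m _
    obtain ⟨c, h, H, hKI, hK⟩ := key m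
    exact flat_FPV_step H I s (fun f hf => (hs f hf).imp fun _ h => h.2) hI hKI hK hflat
  · intro hflat
    have key : ∀ l ≤ n + 1, ∃ c h, Std (R := R) p d l c h ∧ KK p d l c h ≤ I ∧
      ∀ m < l, ∀ v ∈ FPV p R mv d m, v ∈ I → v ∈ KK p d l c h := by
      intro l
      induction l with
      | zero => exact fun _ => base
      | succ l ih =>
        intro hl
        obtain ⟨c, h, H, hKI, hK⟩ := ih (by omega)
        exact step H I hKI hK (hflat l (by omega))
    obtain ⟨c, h, H, hKI, hK⟩ := key (n + 1) le_rfl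
    have : I = KK p d (n + 1) c h := by
      refine le_antisymm ?_ hKI
      conv_lhs => rw [hI]
      refine Ideal.span_le.2 ?_
      intro f hf
      obtain ⟨m, hm, hfm⟩ := hs f hf
      exact hK m (by omega) f hfm (hI ▸ Ideal.subset_span hf)
    rw [this]
    exact flat_quot_KK H

section glob
variable {p : ℕ} {R : Type u} [CommRing R] {mv : ℕ} {d : Fin mv → ℕ}

/-- localization map on polynomial rings -/
noncomputable def ph (R : Type u) [CommRing R] (mv : ℕ) (P : Ideal R) [P.IsPrime] :
    MvPolynomial (Fin mv) R →ₗ[R] MvPolynomial (Fin mv) (Localization.AtPrime P) :=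
  (MvPolynomial.mapAlgHom (Algebra.ofId R (Localization.AtPrime P))).toLinearMap

lemma ph_apply (P : Ideal R) [P.IsPrime] (f : MvPolynomial (Fin mv) R) :
    ph R mv P f = MvPolynomial.map (algebraMap R (Localization.AtPrime P)) f := rfl

instance (P : Ideal R) [P.IsPrime] : IsLocalizedModule P.primeCompl (ph R mv P) :=
  (isLocalizedModule_iff_isBaseChange _ (Localization.AtPrime P) _).mpr
    (.of_equiv (algebraTensorAlgEquiv _ _).toLinearEquiv fun _ ↦ by simp [ph_apply])

lemma ph_FPV (P : Ideal R) [P.IsPrime] (m : ℕ) :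
    (FPV p R mv d m).localized' (Localization.AtPrime P) P.primeCompl (ph R mv P) =
      FPV p (Localization.AtPrime P) mv d m := by
  unfold FPV
  rw [Submodule.localized'_span]
  congr 1
  ext f
  constructor
  · rintro ⟨_, ⟨i, hi, rfl⟩, rfl⟩
    exact ⟨i, hi, by simp [ph_apply]⟩
  · rintro ⟨i, hi, rfl⟩
    exact ⟨_, ⟨i, hi, rfl⟩, by simp [ph_apply]⟩

lemma ph_ideal (P : Ideal R) [P.IsPrime] (I : Ideal (MvPolynomial (Fin mv) R)) :
    (I.restrictScalars R).localized' (Localization.AtPrime P) P.primeCompl (ph R mv P) =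
      (I.map (MvPolynomial.map (algebraMap R (Localization.AtPrime P)))).restrictScalars
        (Localization.AtPrime P) := by
  rw [Submodule.localized'_eq_span]
  apply le_antisymm
  · refine Submodule.span_le.2 ?_
    rintro _ ⟨f, hf, rfl⟩
    exact Ideal.mem_map_of_mem (MvPolynomial.map (algebraMap R (Localization.AtPrime P))) hf
  · intro x hx
    refine idealspan_le ?_ hx
    rintro _ ⟨f, hf, rfl⟩ a
    refine Submodule.subset_span ⟨monomial a 1 * f, I.mul_mem_left _ hf, ?_⟩
    rw [ph_apply, map_mul, map_monomial, map_one]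

lemma loc_iff (hp : p.Prime) [CharP R p] (n : ℕ)
    (I : Ideal (MvPolynomial (Fin mv) R)) (s : Set (MvPolynomial (Fin mv) R))
    (hs : ∀ f ∈ s, ∃ l : ℕ, l ≤ n ∧ f ∈ FPV p R mv d l) (hI : I = Ideal.span s)
    (P : Ideal R) [P.IsPrime] :
    Module.Flat (Localization.AtPrime P) (MvPolynomial (Fin mv) (Localization.AtPrime P) ⧸
      (I.restrictScalars R).localized' (Localization.AtPrime P) P.primeCompl (ph R mv P)) ↔
    ∀ m ≤ n, Module.Flat (Localization.AtPrime P)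
      (((FPV p R mv d m).map (I.restrictScalars R).mkQ).localized' (Localization.AtPrime P)
        P.primeCompl ((I.restrictScalars R).toLocalizedQuotient' (Localization.AtPrime P)
          P.primeCompl (ph R mv P))) := by
  have hfact : Fact p.Prime := ⟨hp⟩
  have hchar : CharP (Localization.AtPrime P) p := by
    rw [CharP.charP_iff_prime_eq_zero hp, ← map_natCast (algebraMap R _), CharP.cast_eq_zero,
      map_zero]
  have h1 : ∀ m, ((FPV p R mv d m).map (I.restrictScalars R).mkQ).localized'
      (Localization.AtPrime P)
        P.primeCompl ((I.restrictScalars R).toLocalizedQuotient' (Localization.AtPrime P)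
          P.primeCompl (ph R mv P)) =
      (FPV p (Localization.AtPrime P) mv d m).map ((I.restrictScalars R).localized'
        (Localization.AtPrime P) P.primeCompl (ph R mv P)).mkQ := by
    intro m
    have h2 := (ph_FPV (p := p) (d := d) P m).symm.trans (Submodule.localized'_eq_span _ _ _ _)
    rw [h2, Submodule.map_span]
    refine (Submodule.localized'_eq_span _ _ _ _).trans ?_
    congr 1
    ext x
    constructor
    · rintro ⟨_, ⟨f, hf, rfl⟩, rfl⟩
      exact ⟨_, ⟨f, hf, rfl⟩, rfl⟩
    · rintro ⟨_, ⟨f, hf, rfl⟩, rfl⟩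
      exact ⟨_, ⟨f, hf, rfl⟩, rfl⟩
  refine Iff.trans ?_ (forall₂_congr fun m _ => by rw [h1 m])
  rw [ph_ideal]
  refine local_iff n _ (MvPolynomial.map (algebraMap R (Localization.AtPrime P)) '' s) ?_ ?_
  · rintro _ ⟨f, hf, rfl⟩
    obtain ⟨l, hl, hfl⟩ := hs f hf
    refine ⟨l, hl, ?_⟩
    rw [← ph_FPV, Submodule.localized'_eq_span]
    exact Submodule.subset_span ⟨f, hfl, rfl⟩
  · rw [hI, Ideal.map_span]

lemma flat_iff_loc (N : Submodule R (MvPolynomial (Fin mv) R)) :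
    Module.Flat R (MvPolynomial (Fin mv) R ⧸ N) ↔ ∀ (P : Ideal R) [P.IsMaximal],
      Module.Flat (Localization.AtPrime P) (MvPolynomial (Fin mv) (Localization.AtPrime P) ⧸
        N.localized' (Localization.AtPrime P) P.primeCompl (ph R mv P)) := by
  constructor
  · intro h P _
    exact Module.Flat.of_isLocalizedModule (Localization.AtPrime P) P.primeCompl
      (N.toLocalizedQuotient' (Localization.AtPrime P) P.primeCompl (ph R mv P))
  · intro h
    refine Module.flat_of_isLocalized_maximal R _ (fun P _ =>
      (MvPolynomial (Fin mv) (Localization.AtPrime P) ⧸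
        N.localized' (Localization.AtPrime P) P.primeCompl (ph R mv P)))
      (fun P _ => N.toLocalizedQuotient' (Localization.AtPrime P) P.primeCompl (ph R mv P)) ?_
    intro P _
    exact (Module.flat_iff_of_isLocalization (Localization.AtPrime P) P.primeCompl _).1 (h P)

lemma flat_iff_loc' (N : Submodule R (MvPolynomial (Fin mv) R))
    (V : Submodule R (MvPolynomial (Fin mv) R ⧸ N)) :
    Module.Flat R V ↔ ∀ (P : Ideal R) [P.IsMaximal],
      Module.Flat (Localization.AtPrime P) (V.localized' (Localization.AtPrime P) P.primeCompl
        (N.toLocalizedQuotient' (Localization.AtPrime P) P.primeCompl (ph R mv P))) := by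
  constructor
  · intro h P _
    exact Module.Flat.of_isLocalizedModule (Localization.AtPrime P) P.primeCompl
      (V.toLocalized' (Localization.AtPrime P) P.primeCompl
        (N.toLocalizedQuotient' (Localization.AtPrime P) P.primeCompl (ph R mv P)))
  · intro h
    refine Module.flat_of_isLocalized_maximal R _ (fun P _ =>
      (V.localized' (Localization.AtPrime P) P.primeCompl
        (N.toLocalizedQuotient' (Localization.AtPrime P) P.primeCompl (ph R mv P))))
      (fun P _ => V.toLocalized' (Localization.AtPrime P) P.primeCompl
        (N.toLocalizedQuotient' (Localization.AtPrime P) P.primeCompl (ph R mv P))) ?_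
    intro P _
    exact (Module.flat_iff_of_isLocalization (Localization.AtPrime P) P.primeCompl _).1 (h P)

end glob
end TwLin

/-- Let `I ⊆ R[𝔛]` be a twisted-linear ideal generated by twisted-linear elements of degree
`≤ p^n` (i.e. lying in `FPV_l(R)` with `l ≤ n`). Then `R[𝔛]/I` is `R`-flat if and only if the
`R`-modules `FPV_m(R)/(FPV_m(R) ∩ I)` are `R`-flat for all `m = 0, 1, …, n`. -/
theorem flat_iff_FPV_quotients_flat
    (p : ℕ) (hp : p.Prime) (R : Type*) [CommRing R] [CharP R p]
    (mv : ℕ) (d : Fin mv → ℕ) (n : ℕ) (I : Ideal (MvPolynomial (Fin mv) R))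
    (htl : ∃ s : Finset (MvPolynomial (Fin mv) R),
      (∀ f ∈ s, ∃ l : ℕ, l ≤ n ∧ f ∈ FPV p R mv d l) ∧ I = Ideal.span s) :
    Module.Flat R (MvPolynomial (Fin mv) R ⧸ I) ↔
      ∀ m : ℕ, m ≤ n →
        Module.Flat R
          (↥(FPV p R mv d m) ⧸
            Submodule.comap (FPV p R mv d m).subtype (I.restrictScalars R)) := by
  obtain ⟨s, hs, hI⟩ := htl
  have e1 : Module.Flat R (MvPolynomial (Fin mv) R ⧸ I) ↔
      Module.Flat R (MvPolynomial (Fin mv) R ⧸ I.restrictScalars R) :=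
    Module.Flat.equiv_iff (Submodule.Quotient.restrictScalarsEquiv R I).symm
  have e2 : ∀ m, Module.Flat R
          (↥(FPV p R mv d m) ⧸
            Submodule.comap (FPV p R mv d m).subtype (I.restrictScalars R)) ↔
      Module.Flat R ((FPV p R mv d m).map (I.restrictScalars R).mkQ) := by
    intro m
    let F := (I.restrictScalars R).mkQ ∘ₗ (FPV p R mv d m).subtype
    have hk : LinearMap.ker F =
        Submodule.comap (FPV p R mv d m).subtype (I.restrictScalars R) := by
      rw [LinearMap.ker_comp, Submodule.ker_mkQ]
    have hr : LinearMap.range F = (FPV p R mv d m).map (I.restrictScalars R).mkQ := by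
      rw [LinearMap.range_comp, Submodule.range_subtype]
    rw [← hk, ← hr]
    exact Module.Flat.equiv_iff F.quotKerEquivRange
  constructor
  · intro h m hm
    exact (e2 m).2 ((TwLin.flat_iff_loc' _ _).2 fun P _ =>
      (TwLin.loc_iff hp n I s hs hI P).1 ((TwLin.flat_iff_loc _).1 (e1.1 h) P) m hm)
  · intro h
    exact e1.2 ((TwLin.flat_iff_loc _).2 fun P _ =>
      (TwLin.loc_iff hp n I s hs hI P).2 fun m hm =>
        (TwLin.flat_iff_loc' _ _).1 ((e2 m).1 (h m hm)) P)
end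

section
/- Let p be a prime, k a field of characteristic p, and let a, b ∈ k be not both zero. Let P ∈ k[x,y] be a homogeneous polynomial of degree p − 1 in two variables such that (a·x + b·y)·P lies in the ideal ⟨x^p, y^p⟩ of k[x,y]. Then there exists γ ∈ k with P = γ·(a·x + b·y)^{p−1}. -/
open MvPolynomial

lemma aux_mem {k : Type*} [Field k] (p : ℕ) (F : MvPolynomial (Fin 2) k)
    (h : F ∈ Ideal.span {(X 0 : MvPolynomial (Fin 2) k) ^ p, (X 1 : MvPolynomial (Fin 2) k) ^ p})
    (d : Fin 2 →₀ ℕ) (hd : ∀ i, d i < p) : coeff d F = 0 := by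
  obtain ⟨u, v, rfl⟩ := Ideal.mem_span_pair.1 h
  have key : ∀ (i : Fin 2) (w : MvPolynomial (Fin 2) k), coeff d (w * X i ^ p) = 0 := by
    intro i w
    rw [X_pow_eq_monomial, coeff_mul_monomial', if_neg]
    intro hle
    have := hle i
    have := hd i
    simp at *
    omega
  rw [coeff_add, key, key, add_zero]

lemma aux_coeff {k : Type*} [Field k] (i j : Fin 2) (hij : i ≠ j) (a b : k) (n : ℕ) :
    coeff (Finsupp.single i n) ((C a * X i + C b * X j : MvPolynomial (Fin 2) k) ^ n) = a ^ n := by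
  induction n with
  | zero => simp
  | succ n ih =>
    have e : (C a * X i + C b * X j : MvPolynomial (Fin 2) k) ^ (n+1)
      = C a * ((C a * X i + C b * X j) ^ n * X i) + C b * ((C a * X i + C b * X j) ^ n * X j) := by
      ring
    have h1 : coeff (Finsupp.single i (n+1)) ((C a * X i + C b * X j : MvPolynomial (Fin 2) k) ^ n * X i)
        = a ^ n := by
      rw [Finsupp.single_add, coeff_mul_X, ih]
    have h2 : coeff (Finsupp.single i (n+1)) ((C a * X i + C b * X j : MvPolynomial (Fin 2) k) ^ n * X j)
        = 0 := by
      rw [coeff_mul_X', if_neg]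
      simp [Finsupp.single_apply, hij]
    rw [e, coeff_add, coeff_C_mul, coeff_C_mul, h1, h2]
    ring

lemma aux_zero {k : Type*} [Field k] (p : ℕ) (hp : 0 < p) (i j : Fin 2) (hij : i ≠ j) (a b : k)
    (ha : a ≠ 0) (R : MvPolynomial (Fin 2) k) (hR : R.IsHomogeneous (p - 1))
    (h : ∀ d : Fin 2 →₀ ℕ, (∀ i, d i < p) → coeff d ((C a * X i + C b * X j) * R) = 0)
    (h0 : coeff (Finsupp.single i (p - 1)) R = 0) : R = 0 := by
  have hall : ∀ l : Fin 2, l = i ∨ l = j := by omega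
  have key : ∀ n : ℕ, ∀ d : Fin 2 →₀ ℕ, d i + d j = p - 1 → d j = n → coeff d R = 0 := by
    intro n
    induction n with
    | zero =>
      intro d hd hj
      have : d = Finsupp.single i (p - 1) := by
        ext l
        rcases hall l with rfl | rfl
        · simp; omega
        · simp [Finsupp.single_apply, hij, hj]
      rw [this, h0]
    | succ n ih =>
      intro d hd hj
      have hle : Finsupp.single j 1 ≤ d := by
        rw [Finsupp.single_le_iff]; omega
      obtain ⟨d', rfl⟩ := exists_add_of_le hle
      have hji := hij.symm
      simp [Finsupp.single_apply, hij, hji] at hd hj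
      have h1 := h (Finsupp.single j 1 + d' + Finsupp.single i 1) (by
        intro l
        rcases hall l with rfl | rfl
        · simp [Finsupp.single_apply, hij, hji]; omega
        · simp [Finsupp.single_apply, hij, hji]; omega)
      have e : (C a * X i + C b * X j) * R = C a * (R * X i) + C b * (R * X j) := by ring
      rw [e, coeff_add, coeff_C_mul, coeff_C_mul, coeff_mul_X,
        show Finsupp.single j 1 + d' + Finsupp.single i 1
          = (d' + Finsupp.single i 1) + Finsupp.single j 1 by abel, coeff_mul_X,
        ih (d' + Finsupp.single i 1) (by simp [Finsupp.single_apply, hij, hji]; omega)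
          (by simp [Finsupp.single_apply, hij, hji]; omega)] at h1
      simpa [ha] using h1
  ext d
  rw [coeff_zero]
  by_contra hne
  have hdeg := hR hne
  apply hne
  refine key _ d ?_ rfl
  rw [← hdeg, Finsupp.weight_apply, Finsupp.sum_fintype _ _ (by simp)]
  have : (i = 0 ∧ j = 1) ∨ (i = 1 ∧ j = 0) := by omega
  rcases this with ⟨rfl, rfl⟩ | ⟨rfl, rfl⟩ <;> simp [Fin.sum_univ_two, add_comm]

lemma aux_main (p : ℕ) (hp : p.Prime) {k : Type*} [Field k] [CharP k p]
    (i j : Fin 2) (hij : i ≠ j) (a b : k) (ha : a ≠ 0)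
    (P : MvPolynomial (Fin 2) k) (hP : P.IsHomogeneous (p - 1))
    (hmem : (C a * X i + C b * X j) * P ∈
      Ideal.span {(X 0 : MvPolynomial (Fin 2) k) ^ p, (X 1 : MvPolynomial (Fin 2) k) ^ p}) :
    ∃ γ : k, P = C γ * (C a * X i + C b * X j) ^ (p - 1) := by
  haveI := Fact.mk hp
  set I := Ideal.span {(X 0 : MvPolynomial (Fin 2) k) ^ p, (X 1 : MvPolynomial (Fin 2) k) ^ p}
    with hI
  have hX : ∀ l : Fin 2, (X l : MvPolynomial (Fin 2) k) ^ p ∈ I := by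
    intro l
    apply Ideal.subset_span
    fin_cases l <;> simp
  have hL : (C a * X i + C b * X j : MvPolynomial (Fin 2) k) ^ p ∈ I := by
    rw [add_pow_char, mul_pow, mul_pow]
    exact I.add_mem (I.mul_mem_left _ (hX i)) (I.mul_mem_left _ (hX j))
  refine ⟨coeff (Finsupp.single i (p - 1)) P / a ^ (p - 1), ?_⟩
  set γ := coeff (Finsupp.single i (p - 1)) P / a ^ (p - 1) with hγ
  rw [← sub_eq_zero]
  apply aux_zero p hp.pos i j hij a b ha
  · apply hP.sub
    have h1 : (C a * X i + C b * X j : MvPolynomial (Fin 2) k).IsHomogeneous 1 :=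
      (isHomogeneous_C_mul_X a i).add (isHomogeneous_C_mul_X b j)
    have := (h1.pow (p - 1)).C_mul γ
    rwa [one_mul] at this
  · intro d hd
    refine aux_mem p _ ?_ d hd
    have e : (C a * X i + C b * X j) * (P - C γ * (C a * X i + C b * X j) ^ (p - 1))
      = (C a * X i + C b * X j) * P - C γ * (C a * X i + C b * X j) ^ p := by
      rw [← mul_pow_sub_one hp.ne_zero (C a * X i + C b * X j)]
      ring
    rw [e]
    exact I.sub_mem hmem (I.mul_mem_left _ hL)
  · rw [coeff_sub, coeff_C_mul, aux_coeff i j hij, hγ, div_mul_cancel₀ _ (pow_ne_zero _ ha), sub_self]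


/-- Let `k` be a field of characteristic `p`, let `a, b ∈ k` be not both zero, and let
`P ∈ k[x,y]` be homogeneous of degree `p − 1` with `(a·x + b·y)·P ∈ ⟨x^p, y^p⟩`. Then
`P = γ·(a·x + b·y)^{p−1}` for some `γ ∈ k`. -/
theorem homogeneous_multiple_of_linear_pow
    (p : ℕ) (hp : p.Prime) (k : Type*) [Field k] [CharP k p]
    (a b : k) (hab : a ≠ 0 ∨ b ≠ 0)
    (P : MvPolynomial (Fin 2) k) (hP : P.IsHomogeneous (p - 1))
    (hmem : (C a * X 0 + C b * X 1) * P ∈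
      Ideal.span {(X 0 : MvPolynomial (Fin 2) k) ^ p, (X 1 : MvPolynomial (Fin 2) k) ^ p}) :
    ∃ γ : k, P = C γ * (C a * X 0 + C b * X 1) ^ (p - 1) := by
  rcases hab with ha | hb
  · exact aux_main p hp 0 1 (by decide) a b ha P hP hmem
  · rw [add_comm] at hmem ⊢
    exact aux_main p hp 1 0 (by decide) b a hb P hP hmem
end

section
/- Let p be a prime, k a field of characteristic p, and k[x_0,…,x_{N−1}] the polynomial ring in N variables. Let φ be the k-algebra endomorphism of k[x_0,…,x_{N−1}] determined by φ(x_j) = x_{j−1}^p for 1 ≤ j ≤ N−1 and φ(x_0) = 0. Let I be an ideal with φ(I) ⊆ I. Suppose d ∈ ℕ, 0 ≤ e ≤ N−1, and a_0,…,a_e ∈ k with a_0 ≠ 0 are such that a_e·x_0^{p^{d+e}} + a_{e−1}·x_1^{p^{d+e−1}} + ⋯ + a_0·x_e^{p^d} ∈ I. Then x_j^{p^{d+e−j}} ∈ I for every 0 ≤ j ≤ e. -/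
open MvPolynomial

/-- The `k`-algebra endomorphism φ ("comultiplication by z") of `k[x_0,…,x_{N-1}]` determined
by `φ(x_j) = x_{j-1}^p` for `1 ≤ j ≤ N−1` and `φ(x_0) = 0`. -/
noncomputable def comultZ (p N : ℕ) (k : Type*) [Field k] :
    MvPolynomial (Fin N) k →ₐ[k] MvPolynomial (Fin N) k :=
  aeval fun j : Fin N =>
    if (j : ℕ) = 0 then 0
    else (X (⟨(j : ℕ) - 1, Nat.lt_of_le_of_lt (Nat.sub_le _ _) j.isLt⟩ : Fin N)) ^ p

/-- Let `I` be an ideal of `k[x_0,…,x_{N-1}]` stable under the endomorphism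
`φ : x_j ↦ x_{j-1}^p, x_0 ↦ 0`. If `a_e·x_0^{p^{d+e}} + a_{e-1}·x_1^{p^{d+e-1}} + ⋯
+ a_0·x_e^{p^d} ∈ I` with `a_0 ≠ 0` and `e ≤ N−1`, then `x_j^{p^{d+e-j}} ∈ I` for all
`0 ≤ j ≤ e`. -/
theorem monomials_mem_of_twistedLinear_mem
    (p : ℕ) (hp : p.Prime) (k : Type*) [Field k] [CharP k p]
    (N : ℕ) (I : Ideal (MvPolynomial (Fin N) k))
    (hI : ∀ f ∈ I, comultZ p N k f ∈ I)
    (d e : ℕ) (he : e < N) (a : Fin (e + 1) → k) (ha0 : a 0 ≠ 0)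
    (hmem : (∑ j : Fin (e + 1),
        C (a j) * X (⟨e - (j : ℕ), Nat.lt_of_le_of_lt (Nat.sub_le _ _) he⟩ : Fin N)
          ^ p ^ (d + (j : ℕ))) ∈ I) :
    ∀ j : Fin (e + 1),
      (X (⟨(j : ℕ), Nat.lt_of_lt_of_le j.isLt he⟩ : Fin N) : MvPolynomial (Fin N) k)
          ^ p ^ (d + e - (j : ℕ)) ∈ I := by
  let z : ℕ → MvPolynomial (Fin N) k := fun i =>
    if i ≤ e then X (⟨e - i, Nat.lt_of_le_of_lt (Nat.sub_le _ _) he⟩ : Fin N) ^ p ^ (d + i) else 0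
  have hz : ∀ i, comultZ p N k (z i) = z (i + 1) := by
    intro i
    have hp0 : ∀ m, p ^ m ≠ 0 := fun m => pow_ne_zero _ hp.ne_zero
    simp only [z]
    rcases lt_trichotomy i e with h | h | h
    · rw [if_pos h.le, if_pos (by omega : i + 1 ≤ e), map_pow, comultZ, aeval_X,
        if_neg (by simp only; omega), ← pow_mul]
      have h1 : e - i - 1 = e - (i + 1) := by omega
      have h2 : p * p ^ (d + i) = p ^ (d + (i + 1)) := by ring
      simp only [h1, h2]
    · subst h
      rw [if_pos le_rfl, if_neg (by omega), map_pow, comultZ, aeval_X,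
        if_pos (by simp), zero_pow (hp0 _)]
    · rw [if_neg (by omega), if_neg (by omega), map_zero]
  have hsum : ∀ t, (∑ j : Fin (e + 1), C (a j) * z (j + t)) ∈ I := by
    intro t
    induction t with
    | zero =>
      convert hmem using 2 with j
      have : (j : ℕ) ≤ e := by omega
      simp [z, this]
    | succ t ih =>
      have := hI _ ih
      rw [map_sum] at this
      convert this using 2 with j
      rw [map_mul, hz, ← algebraMap_eq, AlgHom.commutes]
      rfl
  have step : ∀ t, (∀ i, t < i → z i ∈ I) → z t ∈ I := by
    intro t h
    have h1 := hsum t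
    rw [Fin.sum_univ_succ] at h1
    have h2 : (∑ j : Fin e, C (a j.succ) * z ((j.succ : Fin (e + 1)) + t)) ∈ I :=
      I.sum_mem fun j _ => I.mul_mem_left _ (h _ (by rw [Fin.val_succ]; omega))
    have h3 := (I.add_mem_iff_left h2).1 h1
    have h4 := I.mul_mem_left (C (a 0)⁻¹) h3
    rw [← mul_assoc, ← C_mul, inv_mul_cancel₀ ha0] at h4
    simpa using h4
  have key : ∀ n i, e < i + n → z i ∈ I := by
    intro n
    induction n with
    | zero =>
      intro i h
      have : ¬ i ≤ e := by omega
      simp [z, this]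
    | succ n ih => exact fun i h => step i fun j hj => ih j (by omega)
  intro j
  have hj : (j : ℕ) ≤ e := by omega
  have h := key (e + 1) (e - j) (by omega)
  simp only [z] at h
  rw [if_pos (by omega)] at h
  have h1 : e - (e - (j : ℕ)) = j := by omega
  have h2 : d + (e - (j : ℕ)) = d + e - j := by omega
  simpa only [h1, h2] using h
end

section
/- Let p be a prime, k a field of characteristic p, and k[𝔛] the polynomial ring in the variables x_{i,j} (1 ≤ i ≤ n, 0 ≤ j ≤ N−1), graded by deg x_{i,j} = p^j. Let λ̃, λ̃' ∈ ℕ^n be weakly decreasing with all entries ≤ N, and for a weakly decreasing μ ∈ ℕ^n let I(μ) denote the ideal generated by the variables x_{i,j} with j < μ_i. Let I ⊆ k[𝔛] be a twisted-linear ideal generated by twisted-linear elements of degree ≤ p^{N−1}, whose radical equals I(λ̃') and whose Hilbert function equals that of I(λ̃), i.e. dim_k (k[𝔛]/I)_d = dim_k (k[𝔛]/I(λ̃))_d for all d ∈ ℕ. Then Σ_{i=1}^n λ̃'_i = Σ_{i=1}^n λ̃_i and λ̃' ≤ λ̃ in the dominance order, i.e. Σ_{i=1}^r λ̃'_i ≤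 Σ_{i=1}^r λ̃_i for all 1 ≤ r ≤ n. -/
open MvPolynomial

/-- `FPV16 p n N k l` is the `k`-subspace of the polynomial ring `k[x_{i,j}]`
(`1 ≤ i ≤ n`, `0 ≤ j ≤ N−1`, graded by `deg x_{i,j} = p^j`) spanned by the twisted-linear
monomials `x_{i,j} ^ p^(l - j)` with `j ≤ l`. -/
noncomputable def FPV16 (p n N : ℕ) (k : Type*) [Field k] (l : ℕ) :
    Submodule k (MvPolynomial (Fin n × Fin N) k) :=
  Submodule.span k
    {f | ∃ ij : Fin n × Fin N, (ij.2 : ℕ) ≤ l ∧ f = X ij ^ p ^ (l - (ij.2 : ℕ))}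

/-- `stdIdeal p n N k μ` is the ideal `I(μ)` generated by the variables `x_{i,j}` with
`j < μ_i`. -/
noncomputable def stdIdeal (p n N : ℕ) (k : Type*) [Field k] (μ : Fin n → ℕ) :
    Ideal (MvPolynomial (Fin n × Fin N) k) :=
  Ideal.span {f | ∃ ij : Fin n × Fin N, (ij.2 : ℕ) < μ ij.1 ∧ f = X ij}

/-- The Hilbert function of a graded ideal `I ⊆ k[x_{i,j}]` (grading by `deg x_{i,j} = p^j`):
`d ↦ dim_k (k[𝔛]/I)_d`. -/
noncomputable def hilbertFn16 (p n N : ℕ) (k : Type*) [Field k]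
    (I : Ideal (MvPolynomial (Fin n × Fin N) k)) (d : ℕ) : ℕ :=
  Module.finrank k
    (↥(weightedHomogeneousSubmodule k (fun ij : Fin n × Fin N => p ^ (ij.2 : ℕ)) d) ⧸
      Submodule.comap
        (weightedHomogeneousSubmodule k (fun ij : Fin n × Fin N => p ^ (ij.2 : ℕ)) d).subtype
        (I.restrictScalars k))


namespace TwLin

open Finset

section alg

variable {σ : Type*} {k : Type*} [Field k] (m : MonomialOrder σ)

/-- Reduction by leading terms. -/
theorem le_of_leading (V U : Submodule k (MvPolynomial σ k))
    (H : ∀ f ∈ V, f ≠ 0 → ∃ h, h ∈ V ∧ h ∈ U ∧ h ≠ 0 ∧ m.degree h = m.degree f) : V ≤ U := by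
  have key : ∀ s : m.syn, ∀ f ∈ V, m.toSyn (m.degree f) = s → f ∈ U := by
    intro s
    induction s using WellFoundedLT.induction with
    | ind s ih =>
      intro f hf hs
      by_cases hf0 : f = 0
      · rw [hf0]; exact U.zero_mem
      obtain ⟨h, hV, hU, h0, hd⟩ := H f hf hf0
      set c : k := f.coeff (m.degree f) / h.coeff (m.degree f) with hc
      have hh : h.coeff (m.degree f) ≠ 0 := by
        rw [← hd]; exact m.coeff_degree_ne_zero_iff.2 h0
      set q := f - c • h with hq
      have hqV : q ∈ V := V.sub_mem hf (V.smul_mem _ hV)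
      have hq0 : q.coeff (m.degree f) = 0 := by
        rw [hq, coeff_sub, coeff_smul, hc, smul_eq_mul, div_mul_cancel₀ _ hh, sub_self]
      have hqU : q ∈ U := by
        by_cases hqz : q = 0
        · rw [hqz]; exact U.zero_mem
        refine ih (m.toSyn (m.degree q)) ?_ q hqV rfl
        have hle : m.toSyn (m.degree q) ≤ m.toSyn (m.degree f) := by
          refine m.degree_sub_le.trans ?_
          refine sup_le le_rfl ?_
          rw [← hd]
          exact m.degree_smul_le
        rw [← hs]
        refine lt_of_le_of_ne hle ?_
        intro he
        have he' := m.toSyn.injective he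
        rw [← he'] at hq0
        exact m.coeff_degree_ne_zero_iff.2 hqz hq0
      have : f = q + c • h := by rw [hq]; ring
      rw [this]
      exact U.add_mem hqU (U.smul_mem _ hU)
  intro f hf
  exact key _ f hf rfl

theorem linInd_of_degree (b : (σ →₀ ℕ) → MvPolynomial σ k) (h0 : ∀ α, b α ≠ 0)
    (hd : ∀ α, m.degree (b α) = α) : LinearIndependent k b := by
  classical
  rw [linearIndependent_iff']
  intro s c hs
  by_contra! hne
  obtain ⟨i, hi, hci⟩ := hne
  obtain ⟨α, hα, hmax⟩ := Finset.exists_max_image (s.filter (fun i => c i ≠ 0))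
    (fun α => m.toSyn α) ⟨i, by simp [hi, hci]⟩
  simp only [Finset.mem_filter] at hα hmax
  have hz : (∑ i ∈ s, c i • b i).coeff α = 0 := by rw [hs]; simp
  rw [coeff_sum, Finset.sum_eq_single α] at hz
  · rw [coeff_smul, smul_eq_mul, mul_eq_zero] at hz
    rcases hz with hz | hz
    · exact hα.2 hz
    · have := (m.coeff_degree_ne_zero_iff (f := b α)).2 (h0 α)
      rw [hd] at this
      exact this hz
  · intro β hβ hne
    rw [coeff_smul, smul_eq_mul]
    by_cases hcβ : c β = 0
    · rw [hcβ, zero_mul]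
    · rw [m.coeff_eq_zero_of_lt, mul_zero]
      rw [hd]
      exact lt_of_le_of_ne (hmax β ⟨hβ, hcβ⟩) (fun h => hne (m.toSyn.injective h))
  · intro h; exact absurd hα.1 h

variable [Fintype σ]

/-- The adapted family. -/
noncomputable def bb (g : σ → MvPolynomial σ k) (a : σ → ℕ) (α : σ →₀ ℕ) : MvPolynomial σ k :=
  ∏ v, (g v ^ (α v / a v) * X v ^ (α v % a v))

theorem bb_ne (g : σ → MvPolynomial σ k) (a : σ → ℕ) (hg0 : ∀ v, g v ≠ 0) (α : σ →₀ ℕ) :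
    bb g a α ≠ 0 := by
  unfold bb
  rw [Finset.prod_ne_zero_iff]
  intro v _
  exact mul_ne_zero (pow_ne_zero _ (hg0 v)) (pow_ne_zero _ (X_ne_zero v))

theorem bb_degree (g : σ → MvPolynomial σ k) (a : σ → ℕ) (hg0 : ∀ v, g v ≠ 0)
    (hgd : ∀ v, m.degree (g v) = Finsupp.single v (a v)) (α : σ →₀ ℕ) :
    m.degree (bb g a α) = α := by
  classical
  unfold bb
  rw [m.degree_prod]
  · have : ∀ v ∈ (Finset.univ : Finset σ), m.degree (g v ^ (α v / a v) * X v ^ (α v % a v)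
        : MvPolynomial σ k) = Finsupp.single v (α v) := by
      intro v _
      rw [m.degree_mul (pow_ne_zero _ (hg0 v)) (pow_ne_zero _ (X_ne_zero v)), m.degree_pow,
        m.degree_pow, hgd, m.degree_X]
      simp only [Finsupp.smul_single, ← Finsupp.single_add, smul_eq_mul, mul_one]
      rw [mul_comm, Nat.div_add_mod]
    rw [Finset.sum_congr rfl this]
    exact Finsupp.univ_sum_single α
  · intro v _
    exact mul_ne_zero (pow_ne_zero _ (hg0 v)) (pow_ne_zero _ (X_ne_zero v))

theorem bb_hom (w : σ → ℕ) (g : σ → MvPolynomial σ k) (a : σ → ℕ)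
    (hgh : ∀ v, IsWeightedHomogeneous w (g v) (a v * w v)) (α : σ →₀ ℕ) :
    IsWeightedHomogeneous w (bb g a α) (Finsupp.weight w α) := by
  have : Finsupp.weight w α = ∑ v, α v * w v := by
    rw [Finsupp.weight_apply, Finsupp.sum_fintype _ _ (by simp)]; simp
  rw [this]
  unfold bb
  refine IsWeightedHomogeneous.prod _ _ _ ?_
  intro v _
  have h := ((hgh v).pow (α v / a v)).mul ((isWeightedHomogeneous_X k w v).pow (α v % a v))
  convert h using 1
  simp only [smul_eq_mul]
  rw [← mul_assoc, ← add_mul, mul_comm (α v / a v), Nat.div_add_mod]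

theorem bb_mul (g : σ → MvPolynomial σ k) (a : σ → ℕ) (ha : ∀ v, 0 < a v) (v : σ) (α : σ →₀ ℕ) :
    bb g a (α + Finsupp.single v (a v)) = g v * bb g a α := by
  classical
  unfold bb
  rw [← Finset.mul_prod_erase _ _ (Finset.mem_univ v),
    ← Finset.mul_prod_erase (a := v) _ (fun v => (g v ^ (α v / a v) * X v ^ (α v % a v)))
      (Finset.mem_univ v), ← mul_assoc]
  congr 1
  · simp only [Finsupp.add_apply, Finsupp.single_eq_same, Nat.add_mod_right,
      Nat.add_div_right _ (ha v), pow_succ]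
    ring
  · refine Finset.prod_congr rfl ?_
    intro u hu
    have : u ≠ v := Finset.ne_of_mem_erase hu
    simp [this.symm]

theorem bb_span (g : σ → MvPolynomial σ k) (a : σ → ℕ) (hg0 : ∀ v, g v ≠ 0)
    (hgd : ∀ v, m.degree (g v) = Finsupp.single v (a v)) :
    ⊤ ≤ Submodule.span k (Set.range (bb g a)) := by
  refine le_of_leading m _ _ ?_
  intro f _ hf
  exact ⟨bb g a (m.degree f), trivial, Submodule.subset_span ⟨_, rfl⟩, bb_ne g a hg0 _,
    bb_degree m g a hg0 hgd _⟩

/-- The adapted basis. -/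
noncomputable def bbas (g : σ → MvPolynomial σ k) (a : σ → ℕ) (hg0 : ∀ v, g v ≠ 0)
    (hgd : ∀ v, m.degree (g v) = Finsupp.single v (a v)) :
    Module.Basis (σ →₀ ℕ) k (MvPolynomial σ k) :=
  Module.Basis.mk (linInd_of_degree m (bb g a) (bb_ne g a hg0) (bb_degree m g a hg0 hgd))
    (bb_span m g a hg0 hgd)

theorem bbas_apply (g : σ → MvPolynomial σ k) (a : σ → ℕ) (hg0 : ∀ v, g v ≠ 0)
    (hgd : ∀ v, m.degree (g v) = Finsupp.single v (a v)) (α : σ →₀ ℕ) :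
    bbas m g a hg0 hgd α = bb g a α := by
  simp [bbas]

theorem ideal_eq (g : σ → MvPolynomial σ k) (a : σ → ℕ) (hg0 : ∀ v, g v ≠ 0)
    (hgd : ∀ v, m.degree (g v) = Finsupp.single v (a v)) (ha : ∀ v, 0 < a v) (L : Set σ) :
    (Ideal.span (g '' L)).restrictScalars k =
      Submodule.span k (bb g a '' {α | ∃ v ∈ L, a v ≤ α v}) := by
  apply le_antisymm
  · intro f hf
    rw [Submodule.restrictScalars_mem] at hf
    refine Submodule.span_induction ?_ (Submodule.zero_mem _)
      (fun x y _ _ hx hy => Submodule.add_mem _ hx hy) ?_ hf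
    · rintro _ ⟨v, hv, rfl⟩
      have := bb_mul g a ha v 0
      have h1 : bb g a 0 = 1 := by simp [bb]
      rw [h1, mul_one] at this
      rw [← this]
      exact Submodule.subset_span ⟨_, ⟨v, hv, by simp⟩, rfl⟩
    · intro r x _ hx
      have hr : r ∈ Submodule.span k (Set.range (bb g a)) := bb_span m g a hg0 hgd trivial
      clear hf f
      refine Submodule.span_induction ?_ (by rw [smul_zero]; exact Submodule.zero_mem _)
        (fun x y _ _ hx hy => by rw [smul_add]; exact Submodule.add_mem _ hx hy) ?_ hx
      · rintro _ ⟨α, ⟨v, hv, hav⟩, rfl⟩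
        obtain ⟨β, rfl⟩ : ∃ β, α = β + Finsupp.single v (a v) :=
          ⟨α - Finsupp.single v (a v), by
            rw [tsub_add_cancel_of_le]; simpa using hav⟩
        rw [bb_mul g a ha, smul_eq_mul]
        have hr2 : r * bb g a β ∈ Submodule.span k (Set.range (bb g a)) :=
          bb_span m g a hg0 hgd trivial
        rw [mul_left_comm]
        refine Submodule.span_induction ?_ (by rw [mul_zero]; exact Submodule.zero_mem _)
          (fun x y _ _ hx hy => by rw [mul_add]; exact Submodule.add_mem _ hx hy)
          (fun c x _ hx => by rw [mul_smul_comm]; exact Submodule.smul_mem _ _ hx) hr2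
        rintro _ ⟨γ, rfl⟩
        rw [← bb_mul g a ha]
        exact Submodule.subset_span ⟨_, ⟨v, hv, by simp⟩, rfl⟩
      · intro c x _ hx
        rw [smul_comm]; exact Submodule.smul_mem _ _ hx
  · rw [Submodule.span_le]
    rintro _ ⟨α, ⟨v, hv, hav⟩, rfl⟩
    obtain ⟨β, rfl⟩ : ∃ β, α = β + Finsupp.single v (a v) :=
      ⟨α - Finsupp.single v (a v), by
        rw [tsub_add_cancel_of_le]; simpa using hav⟩
    rw [bb_mul g a ha]
    exact Ideal.mul_mem_right _ _ (Ideal.subset_span ⟨v, hv, rfl⟩)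

theorem finrank_quot (w : σ → ℕ) (g : σ → MvPolynomial σ k) (a : σ → ℕ) (hg0 : ∀ v, g v ≠ 0)
    (hgd : ∀ v, m.degree (g v) = Finsupp.single v (a v)) (ha : ∀ v, 0 < a v)
    (hgh : ∀ v, IsWeightedHomogeneous w (g v) (a v * w v)) (L : Set σ) (d : ℕ) :
    Module.finrank k
    (↥(weightedHomogeneousSubmodule k w d) ⧸
      Submodule.comap (weightedHomogeneousSubmodule k w d).subtype
        ((Ideal.span (g '' L)).restrictScalars k)) =
    Nat.card {α : σ →₀ ℕ // Finsupp.weight w α = d ∧ ∀ v ∈ L, α v < a v} := by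
  classical
  set B := bbas m g a hg0 hgd with hB
  have hBa : ∀ α, B α = bb g a α := bbas_apply m g a hg0 hgd
  have hBf : (bb g a) = B := by ext1 α; rw [hBa]
  have hRd : weightedHomogeneousSubmodule k w d ≤
      Submodule.span k (B '' {α | Finsupp.weight w α = d}) := by
    refine le_of_leading m _ _ ?_
    intro f hf hf0
    have hw : Finsupp.weight w (m.degree f) = d := hf (m.coeff_degree_ne_zero_iff.2 hf0)
    refine ⟨bb g a (m.degree f), ?_, ?_, bb_ne g a hg0 _, bb_degree m g a hg0 hgd _⟩
    · have := bb_hom w g a hgh (m.degree f)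
      rwa [hw] at this
    · rw [← hBf]
      exact Submodule.subset_span ⟨_, hw, rfl⟩
  set G := {α : σ →₀ ℕ // Finsupp.weight w α = d ∧ ∀ v ∈ L, α v < a v} with hG
  let T : MvPolynomial σ k →ₗ[k] (G →₀ k) :=
    (Finsupp.lcomapDomain (Subtype.val : G → (σ →₀ ℕ)) Subtype.val_injective) ∘ₗ
      B.repr.toLinearMap
  have hT : ∀ f x, T f x = B.repr f x.1 := fun f x => rfl
  let T' := T ∘ₗ (weightedHomogeneousSubmodule k w d).subtype
  have hker : LinearMap.ker T' = Submodule.comap (weightedHomogeneousSubmodule k w d).subtype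
        ((Ideal.span (g '' L)).restrictScalars k) := by
    ext ⟨f, hf⟩
    rw [LinearMap.mem_ker, Submodule.mem_comap, ideal_eq m g a hg0 hgd ha L, hBf,
      Module.Basis.mem_span_image]
    have h1 := hRd hf
    rw [Module.Basis.mem_span_image] at h1
    simp only [Submodule.subtype_apply]
    constructor
    · intro h α hα
      by_contra hbad
      simp only [Set.mem_ofPred_eq, not_exists, not_and, not_le] at hbad
      have := DFunLike.congr_fun h (⟨α, h1 hα, hbad⟩ : G)
      change B.repr f α = 0 at this
      simp [this] at hα
    · intro h
      ext ⟨α, h2, h3⟩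
      change B.repr f α = 0
      by_contra hne
      obtain ⟨v, hv, hav⟩ := h (show α ∈ _ by simpa using hne)
      exact absurd (h3 v hv) (by omega)
  have hsurj : Function.Surjective T' := by
    rw [← LinearMap.range_eq_top, eq_top_iff, ← (Finsupp.basisSingleOne (R := k) (ι := G)).span_eq,
      Submodule.span_le]
    rintro _ ⟨⟨α, h2, h3⟩, rfl⟩
    have hh := bb_hom w g a hgh α
    rw [h2] at hh
    refine ⟨⟨bb g a α, hh⟩, ?_⟩
    ext ⟨β, hβ⟩
    change B.repr (bb g a α) β = _
    rw [← hBa, Module.Basis.repr_self]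
    rw [Finsupp.coe_basisSingleOne, Finsupp.single_apply, Finsupp.single_apply]
    by_cases hαβ : α = β
    · subst hαβ
      rw [if_pos rfl, if_pos rfl]
    · rw [if_neg hαβ, if_neg (fun h => hαβ (congrArg Subtype.val h))]
  rw [← hker, (LinearMap.quotKerEquivOfSurjective T' hsurj).finrank_eq,
    Module.finrank_eq_nat_card_basis (Finsupp.basisSingleOne (R := k) (ι := G))]

end alg

section comb

theorem prod_one_sub (A : Multiset ℕ) (M : ℕ) (hM : 0 < M) (hA : ∀ a ∈ A, M ≤ a) :
    ∃ q : PowerSeries ℤ, (A.map (fun a => (1 - PowerSeries.X ^ a : PowerSeries ℤ))).prod =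
      1 - (A.count M : PowerSeries ℤ) * PowerSeries.X ^ M + PowerSeries.X ^ (M + 1) * q := by
  induction A using Multiset.induction with
  | empty => exact ⟨0, by simp⟩
  | cons a A ih =>
    obtain ⟨q, hq⟩ := ih (fun b hb => hA b (Multiset.mem_cons_of_mem hb))
    have ha := hA a (Multiset.mem_cons_self _ _)
    rw [Multiset.map_cons, Multiset.prod_cons, hq]
    obtain ⟨M', rfl⟩ : ∃ M', M = M' + 1 := ⟨M - 1, by omega⟩
    rcases Nat.eq_or_lt_of_le ha with h | h
    · subst h
      rw [Multiset.count_cons_self]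
      refine ⟨q + (A.count (M' + 1) : PowerSeries ℤ) * PowerSeries.X ^ M' -
        PowerSeries.X ^ (M' + 1) * q, ?_⟩
      push_cast
      ring
    · rw [Multiset.count_cons_of_ne (by omega)]
      obtain ⟨c, rfl⟩ : ∃ c, a = M' + 1 + 1 + c := ⟨a - (M' + 1 + 1), by omega⟩
      refine ⟨q - PowerSeries.X ^ c * (1 - (A.count (M' + 1) : PowerSeries ℤ) *
        PowerSeries.X ^ (M' + 1) + PowerSeries.X ^ (M' + 1 + 1) * q), ?_⟩
      ring

theorem count_of_prod (A : Multiset ℕ) (M : ℕ) (hM : 0 < M) (hA : ∀ a ∈ A, M ≤ a) :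
    PowerSeries.coeff M (A.map (fun a => (1 - PowerSeries.X ^ a : PowerSeries ℤ))).prod =
      - (A.count M : ℤ) := by
  obtain ⟨q, hq⟩ := prod_one_sub A M hM hA
  rw [hq, map_add, map_sub, PowerSeries.coeff_X_pow_mul']
  have : ((A.count M : ℕ) : PowerSeries ℤ) = PowerSeries.C ((A.count M : ℕ) : ℤ) := by simp
  rw [this, PowerSeries.coeff_C_mul, PowerSeries.coeff_X_pow, PowerSeries.coeff_one]
  simp
  omega

theorem one_sub_ne (a : ℕ) (ha : 0 < a) : (1 - PowerSeries.X ^ a : PowerSeries ℤ) ≠ 0 := by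
  intro h
  have := congrArg (PowerSeries.coeff 0) h
  rw [map_sub, PowerSeries.coeff_X_pow, if_neg ha.ne] at this
  simp at this

theorem multiset_eq (A B : Multiset ℕ) (hA : ∀ a ∈ A, 0 < a) (hB : ∀ a ∈ B, 0 < a)
    (h : (A.map (fun a => (1 - PowerSeries.X ^ a : PowerSeries ℤ))).prod =
      (B.map (fun a => (1 - PowerSeries.X ^ a : PowerSeries ℤ))).prod) : A = B := by
  ext M
  induction M using Nat.strong_induction_on with
  | _ M ih =>
    rcases Nat.eq_zero_or_pos M with rfl | hM
    · rw [Multiset.count_eq_zero_of_notMem (fun h => (hA _ h).ne rfl),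
        Multiset.count_eq_zero_of_notMem (fun h => (hB _ h).ne rfl)]
    have hlt : A.filter (· < M) = B.filter (· < M) := by
      ext j
      by_cases hj : j < M
      · rw [Multiset.count_filter_of_pos (p := (· < M)) hj,
          Multiset.count_filter_of_pos (p := (· < M)) hj, ih j hj]
      · rw [Multiset.count_filter_of_neg (p := (· < M)) hj,
          Multiset.count_filter_of_neg (p := (· < M)) hj]
    rw [← Multiset.filter_add_not (· < M) A, ← Multiset.filter_add_not (· < M) B,
      Multiset.map_add, Multiset.map_add, Multiset.prod_add, Multiset.prod_add, hlt] at h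
    have hne : ((B.filter (· < M)).map
        (fun a => (1 - PowerSeries.X ^ a : PowerSeries ℤ))).prod ≠ 0 := by
      rw [Ne, Multiset.prod_eq_zero_iff, Multiset.mem_map]
      rintro ⟨a, ha, h0⟩
      exact one_sub_ne a (hB a (Multiset.mem_of_mem_filter ha)) h0
    have h2 := congrArg (PowerSeries.coeff M) (mul_left_cancel₀ hne h)
    rw [count_of_prod _ _ hM (by simp), count_of_prod _ _ hM (by simp)] at h2
    rw [Multiset.count_filter_of_pos (p := fun a => ¬ a < M) (lt_irrefl _),
      Multiset.count_filter_of_pos (p := fun a => ¬ a < M) (lt_irrefl _)] at h2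
    omega

variable {σ : Type*} [Fintype σ]

open Classical in
/-- local generating function -/
noncomputable def ff (w : ℕ) (P : ℕ → Prop) : PowerSeries ℤ :=
  PowerSeries.mk (fun e => if ∃ c, P c ∧ e = c * w then 1 else 0)

theorem ff_top (w : ℕ) (hw : 0 < w) : ff w (fun _ => True) * (1 - PowerSeries.X ^ w) = 1 := by
  classical
  ext e
  rw [mul_sub, mul_one, map_sub, PowerSeries.coeff_mul_X_pow', PowerSeries.coeff_one]
  simp only [ff, PowerSeries.coeff_mk, true_and]
  by_cases h : w ≤ e
  · have h1 : (∃ c, e = c * w) ↔ ∃ c, e - w = c * w := by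
      constructor
      · rintro ⟨c, rfl⟩; exact ⟨c - 1, by rw [Nat.sub_mul, one_mul]⟩
      · rintro ⟨c, hc⟩; exact ⟨c + 1, by rw [add_mul, one_mul]; omega⟩
    simp only [h, if_true, h1, sub_self]
    rw [if_neg (by omega)]
  · simp only [h, if_false, sub_zero]
    congr 1
    apply propext
    constructor
    · rintro ⟨c, rfl⟩
      rcases Nat.eq_zero_or_pos c with rfl | hc
      · simp
      · exact absurd (Nat.le_mul_of_pos_left w hc) h
    · rintro rfl; exact ⟨0, by simp⟩

theorem ff_lt (w a : ℕ) (hw : 0 < w) :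
    ff w (fun c => c < a) * (1 - PowerSeries.X ^ w) = 1 - PowerSeries.X ^ (a * w) := by
  have h1 : ff w (fun c => c < a) = ff w (fun _ => True) * (1 - PowerSeries.X ^ (a * w)) := by
    classical
    ext e
    rw [mul_sub, mul_one, map_sub, PowerSeries.coeff_mul_X_pow']
    simp only [ff, PowerSeries.coeff_mk, true_and]
    by_cases h : ∃ c, e = c * w
    · obtain ⟨c, rfl⟩ := h
      have hA : (∃ c', c' < a ∧ c * w = c' * w) ↔ c < a := by
        constructor
        · rintro ⟨c', h, h'⟩; rwa [Nat.eq_of_mul_eq_mul_right hw h']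
        · intro h; exact ⟨c, h, rfl⟩
      have hB : a * w ≤ c * w ↔ ¬ c < a := by
        rw [Nat.mul_le_mul_right_iff hw]; omega
      have hC : ∃ c', c * w - a * w = c' * w := ⟨c - a, by rw [Nat.sub_mul]⟩
      have hD : ∃ c', c * w = c' * w := ⟨c, rfl⟩
      simp only [hA, hB, hC, hD, if_true]
      by_cases hc : c < a <;> simp [hc]
    · have h' : ¬ ∃ c, c < a ∧ e = c * w := fun ⟨c, _, hc⟩ => h ⟨c, hc⟩
      rw [if_neg h', if_neg h]
      by_cases hae : a * w ≤ e
      · rw [if_pos hae, if_neg, sub_zero]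
        rintro ⟨c, hc⟩
        exact h ⟨c + a, by rw [add_mul]; omega⟩
      · rw [if_neg hae, sub_zero]
  rw [h1, mul_right_comm, ff_top w hw, one_mul]

theorem card_eq_coeff (w : σ → ℕ) (hw : ∀ v, 0 < w v) (P : σ → ℕ → Prop) (d : ℕ) :
    ((Nat.card {α : σ →₀ ℕ // Finsupp.weight w α = d ∧ ∀ v, P v (α v)} : ℕ) : ℤ) =
      PowerSeries.coeff d (∏ v, ff (w v) (P v)) := by
  classical
  rw [PowerSeries.coeff_prod]
  simp only [ff, PowerSeries.coeff_mk]
  have : ∀ l ∈ Finset.finsuppAntidiag (Finset.univ : Finset σ) d,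
      (∏ i, if ∃ c, P i c ∧ l i = c * w i then (1 : ℤ) else 0) =
      if ∀ i, ∃ c, P i c ∧ l i = c * w i then 1 else 0 := by
    intro l _
    rw [Finset.prod_ite_zero]
    simp
  rw [Finset.sum_congr rfl this, Finset.sum_boole]
  congr 1
  rw [← Nat.card_eq_finsetCard]
  refine Nat.card_congr (Equiv.ofBijective (fun α => ⟨Finsupp.equivFunOnFinite.symm
    (fun v => α.1 v * w v), ?_⟩) ⟨?_, ?_⟩)
  · obtain ⟨α, h1, h2⟩ := α
    rw [Finset.mem_filter, Finset.mem_finsuppAntidiag]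
    refine ⟨⟨?_, Finset.subset_univ _⟩, fun i => ⟨α i, h2 i, rfl⟩⟩
    have h3 := h1
    rw [Finsupp.weight_apply, Finsupp.sum_fintype _ _ (by simp)] at h3
    exact h3
  · rintro ⟨α, h1, h2⟩ ⟨β, h3, h4⟩ h
    have h := congrArg Subtype.val h
    ext v
    have := DFunLike.congr_fun h v
    exact Nat.eq_of_mul_eq_mul_right (hw v) this
  · rintro ⟨l, hl⟩
    rw [Finset.mem_filter, Finset.mem_finsuppAntidiag] at hl
    choose c hc hlc using hl.2
    have he : Finsupp.equivFunOnFinite.symm (fun v => c v * w v) = l := by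
      ext v; exact (hlc v).symm
    refine ⟨⟨Finsupp.equivFunOnFinite.symm c, ?_, hc⟩, Subtype.ext he⟩
    rw [← hl.1.1, Finsupp.weight_apply, Finsupp.sum_fintype _ _ (by simp)]
    exact Finset.sum_congr rfl (fun v _ => (hlc v).symm)

open Classical in
theorem prod_eq_of_card (w : σ → ℕ) (hw : ∀ v, 0 < w v) (L : Set σ) (a : σ → ℕ) :
    (∏ v, ff (w v) (fun c => v ∈ L → c < a v)) * ∏ v, (1 - PowerSeries.X ^ (w v)) =
      ∏ v ∈ L.toFinset, (1 - PowerSeries.X ^ (a v * w v) : PowerSeries ℤ) := by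
  rw [← Finset.prod_mul_distrib]
  have : ∀ v ∈ (Finset.univ : Finset σ),
      ff (w v) (fun c => v ∈ L → c < a v) * (1 - PowerSeries.X ^ (w v)) =
      if v ∈ L.toFinset then (1 - PowerSeries.X ^ (a v * w v) : PowerSeries ℤ) else 1 := by
    intro v _
    by_cases hv : v ∈ L
    · simp only [hv, forall_const, Set.mem_toFinset, if_true]
      exact ff_lt _ _ (hw v)
    · simp only [hv, false_imp_iff, Set.mem_toFinset, if_false]
      exact ff_top _ (hw v)
  rw [Finset.prod_congr rfl this, Finset.prod_ite_mem, Finset.univ_inter]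

open Classical in
theorem multiset_of_card (w : σ → ℕ) (hw : ∀ v, 0 < w v) (L L' : Set σ) (a a' : σ → ℕ)
    (ha : ∀ v, 0 < a v) (ha' : ∀ v, 0 < a' v)
    (h : ∀ d, Nat.card {α : σ →₀ ℕ // Finsupp.weight w α = d ∧ ∀ v ∈ L, α v < a v} =
      Nat.card {α : σ →₀ ℕ // Finsupp.weight w α = d ∧ ∀ v ∈ L', α v < a' v}) :
    L.toFinset.val.map (fun v => a v * w v) = L'.toFinset.val.map (fun v => a' v * w v) := by
  apply multiset_eq
  · intro b hb
    obtain ⟨v, _, rfl⟩ := Multiset.mem_map.1 hb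
    exact Nat.mul_pos (ha v) (hw v)
  · intro b hb
    obtain ⟨v, _, rfl⟩ := Multiset.mem_map.1 hb
    exact Nat.mul_pos (ha' v) (hw v)
  · rw [Multiset.map_map, Multiset.map_map]
    change (∏ v ∈ L.toFinset, (1 - PowerSeries.X ^ (a v * w v) : PowerSeries ℤ)) =
      ∏ v ∈ L'.toFinset, (1 - PowerSeries.X ^ (a' v * w v) : PowerSeries ℤ)
    rw [← prod_eq_of_card w hw, ← prod_eq_of_card w hw]
    congr 1
    ext d
    rw [← card_eq_coeff w hw, ← card_eq_coeff w hw]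
    exact_mod_cast h d

/-- Final combinatorial step. -/
theorem dominance (n : ℕ) (lam lam' : Fin n → ℕ) (hlam : Antitone lam)
    (hs : ∑ i, lam' i = ∑ i, lam i)
    (hm : ∀ M, ∑ i, min (lam i) M ≤ ∑ i, min (lam' i) M) (r : ℕ) (hr : r ≤ n) :
    ∑ i ∈ Finset.univ.filter (fun i : Fin n => (i : ℕ) < r), lam' i
      ≤ ∑ i ∈ Finset.univ.filter (fun i : Fin n => (i : ℕ) < r), lam i := by
  rcases Nat.eq_or_lt_of_le hr with rfl | hr
  · simp [hs]
  set M := lam ⟨r, hr⟩ with hM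
  have h := hm M
  have e1 : ∀ f : Fin n → ℕ, ∑ i, min (f i) M + ∑ i, (f i - M) = ∑ i, f i := by
    intro f
    rw [← Finset.sum_add_distrib]
    exact Finset.sum_congr rfl (fun i _ => by omega)
  have h1 := e1 lam
  have h2 := e1 lam'
  have h3 : ∑ i ∈ Finset.univ.filter (fun i : Fin n => (i : ℕ) < r), (lam' i - M) ≤
      ∑ i, (lam' i - M) := Finset.sum_le_sum_of_subset (Finset.filter_subset _ _)
  have h4 : ∑ i ∈ Finset.univ.filter (fun i : Fin n => (i : ℕ) < r), (lam i - M) =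
      ∑ i, (lam i - M) := by
    refine Finset.sum_subset (Finset.filter_subset _ _) ?_
    intro i _ hi
    simp only [Finset.mem_filter, Finset.mem_univ, true_and, not_lt] at hi
    have := hlam (show (⟨r, hr⟩ : Fin n) ≤ i from hi)
    omega
  have h5 : ∑ i ∈ Finset.univ.filter (fun i : Fin n => (i : ℕ) < r), lam i =
      ∑ i ∈ Finset.univ.filter (fun i : Fin n => (i : ℕ) < r), (lam i - M) +
      ∑ i ∈ Finset.univ.filter (fun i : Fin n => (i : ℕ) < r), M := by
    rw [← Finset.sum_add_distrib]
    refine Finset.sum_congr rfl (fun i hi => ?_)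
    simp only [Finset.mem_filter, Finset.mem_univ, true_and] at hi
    have := hlam (show i ≤ (⟨r, hr⟩ : Fin n) from hi.le)
    omega
  have h6 : ∑ i ∈ Finset.univ.filter (fun i : Fin n => (i : ℕ) < r), lam' i ≤
      ∑ i ∈ Finset.univ.filter (fun i : Fin n => (i : ℕ) < r), (lam' i - M) +
      ∑ i ∈ Finset.univ.filter (fun i : Fin n => (i : ℕ) < r), M := by
    rw [← Finset.sum_add_distrib]
    exact Finset.sum_le_sum (fun i _ => by omega)
  omega

theorem card_filter_min (n N : ℕ) (lam : Fin n → ℕ) (hN : ∀ i, lam i ≤ N) (M : ℕ) :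
    (Finset.univ.filter (fun v : Fin n × Fin N => (v.2 : ℕ) < lam v.1 ∧ (v.2 : ℕ) < M)).card =
      ∑ i, min (lam i) M := by
  rw [Finset.card_filter, Fintype.sum_prod_type]
  refine Finset.sum_congr rfl (fun i _ => ?_)
  rw [← Finset.card_filter]
  have := hN i
  have h := @Fin.card_filter_val_lt N (min (lam i) M)
  rw [min_eq_right (le_trans (min_le_left _ _) this)] at h
  rw [← h]
  congr 1
  ext j
  simp

end comb

section main

theorem exists_mo (σ : Type) [Finite σ] : Nonempty (MonomialOrder.{0, 0} σ) := by
  classical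
  let _ : LinearOrder σ := linearOrderOfSTO WellOrderingRel
  exact ⟨MonomialOrder.lex⟩

variable {p n N : ℕ} {k : Type*} [Field k]

theorem FPV_support (l : ℕ) (f : MvPolynomial (Fin n × Fin N) k) (hf : f ∈ FPV16 p n N k l)
    (α : Fin n × Fin N →₀ ℕ) (hα : f.coeff α ≠ 0) :
    ∃ v : Fin n × Fin N, (v.2 : ℕ) ≤ l ∧ α = Finsupp.single v (p ^ (l - (v.2 : ℕ))) := by
  classical
  unfold FPV16 at hf
  induction hf using Submodule.span_induction with
  | mem x hx =>
    obtain ⟨v, hv, rfl⟩ := hx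
    rw [coeff_X_pow] at hα
    refine ⟨v, hv, ?_⟩
    by_contra h
    exact hα (if_neg (fun h' => h h'.symm))
  | zero => simp at hα
  | add x y _ _ hx hy =>
    by_cases h : x.coeff α = 0
    · by_cases h' : y.coeff α = 0
      · rw [coeff_add, h, h', add_zero] at hα
        exact absurd rfl hα
      · exact hy h'
    · exact hx h
  | smul c x _ hx =>
    apply hx
    intro h
    rw [coeff_smul, h, smul_zero] at hα
    exact hα rfl

theorem FPV_pow_one (hp : p.Prime) [CharP k p] (l : ℕ) (f : MvPolynomial (Fin n × Fin N) k)
    (hf : f ∈ FPV16 p n N k l) : f ^ p ∈ FPV16 p n N k (l + 1) := by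
  have : Fact p.Prime := ⟨hp⟩
  unfold FPV16 at hf
  induction hf using Submodule.span_induction with
  | mem x hx =>
    obtain ⟨v, hv, rfl⟩ := hx
    refine Submodule.subset_span ⟨v, by omega, ?_⟩
    rw [← pow_mul, ← pow_succ]
    congr 2
    omega
  | zero => rw [zero_pow hp.ne_zero]; exact Submodule.zero_mem _
  | add x y _ _ hx hy => rw [add_pow_char]; exact Submodule.add_mem _ hx hy
  | smul c x _ hx => rw [smul_pow]; exact Submodule.smul_mem _ _ hx

theorem FPV_pow (hp : p.Prime) [CharP k p] (l e : ℕ) (f : MvPolynomial (Fin n × Fin N) k)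
    (hf : f ∈ FPV16 p n N k l) : f ^ p ^ e ∈ FPV16 p n N k (l + e) := by
  induction e with
  | zero => simpa using hf
  | succ e ih =>
    rw [pow_succ, pow_mul]
    exact FPV_pow_one hp _ _ ih

theorem FPV_hom (l : ℕ) (f : MvPolynomial (Fin n × Fin N) k) (hf : f ∈ FPV16 p n N k l) :
    IsWeightedHomogeneous (fun ij : Fin n × Fin N => p ^ (ij.2 : ℕ)) f (p ^ l) := by
  intro α hα
  obtain ⟨v, hv, rfl⟩ := FPV_support l f hf α hα
  rw [Finsupp.weight_single, smul_eq_mul, ← pow_add]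
  congr 1
  omega

theorem std_mem (mu : Fin n → ℕ) (f : MvPolynomial (Fin n × Fin N) k) :
    f ∈ stdIdeal p n N k mu ↔
      ∀ α ∈ f.support, ∃ v : Fin n × Fin N, (v.2 : ℕ) < mu v.1 ∧ α v ≠ 0 := by
  have : stdIdeal p n N k mu =
      Ideal.span (X '' {v : Fin n × Fin N | (v.2 : ℕ) < mu v.1}) := by
    unfold stdIdeal
    congr 1
    ext f
    constructor
    · rintro ⟨v, hv, rfl⟩; exact ⟨v, hv, rfl⟩
    · rintro ⟨v, hv, rfl⟩; exact ⟨v, hv, rfl⟩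
  rw [this, mem_ideal_span_X_image]
  rfl

/-- Structure of twisted-linear ideals. -/
theorem structure_thm (hp : p.Prime) [CharP k p] (m : MonomialOrder (Fin n × Fin N))
    (I : Ideal (MvPolynomial (Fin n × Fin N) k))
    (htl : ∃ s : Finset (MvPolynomial (Fin n × Fin N) k),
      (∀ f ∈ s, ∃ l : ℕ, l ≤ N - 1 ∧ f ∈ FPV16 p n N k l) ∧ I = Ideal.span s) :
    ∃ (L : Set (Fin n × Fin N)) (g : Fin n × Fin N → MvPolynomial (Fin n × Fin N) k)
      (l : Fin n × Fin N → ℕ),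
      (∀ v, (v.2 : ℕ) ≤ l v) ∧ (∀ v, g v ≠ 0) ∧
      (∀ v, m.degree (g v) = Finsupp.single v (p ^ (l v - (v.2 : ℕ)))) ∧
      (∀ v, g v ∈ FPV16 p n N k (l v)) ∧
      (∀ v, v ∉ L → g v = X v ∧ l v = (v.2 : ℕ)) ∧ I = Ideal.span (g '' L) := by
  classical
  let D : Fin n × Fin N → ℕ → MvPolynomial (Fin n × Fin N) k → Prop := fun v l f =>
    f ∈ I ∧ f ∈ FPV16 p n N k l ∧ f ≠ 0 ∧ (v.2 : ℕ) ≤ l ∧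
      m.degree f = Finsupp.single v (p ^ (l - (v.2 : ℕ)))
  let L : Set (Fin n × Fin N) := {v | ∃ l f, D v l f}
  have hex : ∀ v, ∃ (l : ℕ) (g : MvPolynomial (Fin n × Fin N) k), (v.2 : ℕ) ≤ l ∧ g ≠ 0 ∧
      m.degree g = Finsupp.single v (p ^ (l - (v.2 : ℕ))) ∧ g ∈ FPV16 p n N k l ∧
      (v ∉ L → g = X v ∧ l = (v.2 : ℕ)) ∧
      (v ∈ L → g ∈ I ∧ ∀ l' f', D v l' f' → l ≤ l') := by
    intro v
    by_cases hv : v ∈ L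
    · have hv' : ∃ l f, D v l f := hv
      obtain ⟨f, hf⟩ := Nat.find_spec hv'
      exact ⟨Nat.find hv', f, hf.2.2.2.1, hf.2.2.1, hf.2.2.2.2, hf.2.1, fun h => absurd hv h,
        fun _ => ⟨hf.1, fun l' f' h' => Nat.find_min' hv' ⟨f', h'⟩⟩⟩
    · refine ⟨v.2, X v, le_rfl, X_ne_zero v, ?_, ?_, fun _ => ⟨rfl, rfl⟩, fun h => absurd h hv⟩
      · rw [m.degree_X]; simp
      · exact Submodule.subset_span ⟨v, le_rfl, by simp⟩
  choose l g h1 h2 h3 h4 h5 h6 using hex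
  refine ⟨L, g, l, h1, h2, h3, h4, h5, ?_⟩
  apply le_antisymm
  · obtain ⟨s, hs, hI⟩ := htl
    have key : ∀ l', (I.restrictScalars k) ⊓ FPV16 p n N k l' ≤
        (Ideal.span (g '' L)).restrictScalars k := by
      intro l'
      refine le_of_leading m _ _ ?_
      rintro f ⟨hfI, hfl⟩ hf0
      obtain ⟨v, hv, hd⟩ := FPV_support l' f hfl _ (m.coeff_degree_ne_zero_iff.2 hf0)
      have hD : D v l' f := ⟨hfI, hfl, hf0, hv, hd⟩
      have hvL : v ∈ L := ⟨l', f, hD⟩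
      have hll := (h6 v hvL).2 l' f hD
      have hpos : p ^ (l' - l v) ≠ 0 := pow_ne_zero _ hp.ne_zero
      refine ⟨g v ^ p ^ (l' - l v), ⟨?_, ?_⟩, ?_, pow_ne_zero _ (h2 v), ?_⟩
      · exact Ideal.pow_mem_of_mem _ (h6 v hvL).1 _ (Nat.pos_of_ne_zero hpos)
      · have := FPV_pow hp (l v) (l' - l v) (g v) (h4 v)
        rwa [Nat.add_sub_cancel' hll] at this
      · exact Ideal.pow_mem_of_mem _ (Ideal.subset_span (Set.mem_image_of_mem g hvL)) _ (Nat.pos_of_ne_zero hpos)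
      · rw [m.degree_pow, h3, hd, Finsupp.smul_single, smul_eq_mul, ← pow_add]
        have := h1 v
        congr 2
        omega
    conv_lhs => rw [hI]
    rw [Ideal.span_le]
    intro f hf
    obtain ⟨l', _, hfl⟩ := hs f hf
    have hfI : f ∈ I := by rw [hI]; exact Ideal.subset_span hf
    exact key l' (Submodule.mem_inf.2 ⟨hfI, hfl⟩)
  · rw [Ideal.span_le]
    rintro _ ⟨v, hv, rfl⟩
    exact (h6 v hv).1

end main

end TwLin

/-- Let `λ̃, λ̃' ∈ ℕ^n` be weakly decreasing with entries `≤ N`, and let `I` be a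
twisted-linear ideal of `k[x_{i,j}]` generated by twisted-linear elements of degree
`≤ p^{N−1}`, whose radical is `I(λ̃')` and whose Hilbert function equals that of `I(λ̃)`.
Then `Σ λ̃'_i = Σ λ̃_i` and `λ̃' ≤ λ̃` in the dominance order. -/
theorem invariants_le_of_twistedLinear
    (p : ℕ) (hp : p.Prime) (k : Type*) [Field k] [CharP k p]
    (n N : ℕ) (lam lam' : Fin n → ℕ)
    (hlam : Antitone lam) (hlam' : Antitone lam')
    (hlamN : ∀ i, lam i ≤ N) (hlam'N : ∀ i, lam' i ≤ N)
    (I : Ideal (MvPolynomial (Fin n × Fin N) k))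
    (htl : ∃ s : Finset (MvPolynomial (Fin n × Fin N) k),
      (∀ f ∈ s, ∃ l : ℕ, l ≤ N - 1 ∧ f ∈ FPV16 p n N k l) ∧ I = Ideal.span s)
    (hrad : I.radical = stdIdeal p n N k lam')
    (hHF : ∀ d : ℕ,
      hilbertFn16 p n N k I d = hilbertFn16 p n N k (stdIdeal p n N k lam) d) :
    (∑ i, lam' i = ∑ i, lam i) ∧
      ∀ r : ℕ, 1 ≤ r → r ≤ n →
        ∑ i ∈ Finset.univ.filter (fun i : Fin n => (i : ℕ) < r), lam' i
          ≤ ∑ i ∈ Finset.univ.filter (fun i : Fin n => (i : ℕ) < r), lam i := by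
  classical
  obtain ⟨m⟩ := TwLin.exists_mo (Fin n × Fin N)
  obtain ⟨L, g, l, h1, h2, h3, h4, h5, h6⟩ := TwLin.structure_thm hp m I htl
  set w : Fin n × Fin N → ℕ := fun ij => p ^ (ij.2 : ℕ) with hw
  have hw0 : ∀ v, 0 < w v := fun v => pow_pos hp.pos _
  set a : Fin n × Fin N → ℕ := fun v => p ^ (l v - (v.2 : ℕ)) with ha
  have ha0 : ∀ v, 0 < a v := fun v => pow_pos hp.pos _
  have haw : ∀ v, a v * w v = p ^ l v := by
    intro v
    have := h1 v
    simp only [ha, hw, ← pow_add]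
    congr 1
    omega
  have hgh : ∀ v, IsWeightedHomogeneous w (g v) (a v * w v) := by
    intro v; rw [haw]; exact TwLin.FPV_hom _ _ (h4 v)
  let L0 : Set (Fin n × Fin N) := {v | (v.2 : ℕ) < lam v.1}
  have hstd : stdIdeal p n N k lam = Ideal.span (X '' L0) := by
    unfold stdIdeal
    congr 1
    ext f
    constructor
    · rintro ⟨v, hv, rfl⟩; exact ⟨v, hv, rfl⟩
    · rintro ⟨v, hv, rfl⟩; exact ⟨v, hv, rfl⟩
  have hcard : ∀ d, Nat.card {α : Fin n × Fin N →₀ ℕ //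
        Finsupp.weight w α = d ∧ ∀ v ∈ L, α v < a v} =
      Nat.card {α : Fin n × Fin N →₀ ℕ //
        Finsupp.weight w α = d ∧ ∀ v ∈ L0, α v < (fun _ => 1 : Fin n × Fin N → ℕ) v} := by
    intro d
    have := hHF d
    unfold hilbertFn16 at this
    rw [hstd, h6] at this
    rw [← TwLin.finrank_quot m w g a h2 h3 ha0 hgh L d,
      ← TwLin.finrank_quot m w (fun v => (X v : MvPolynomial (Fin n × Fin N) k)) (fun _ => 1)
        (fun v => X_ne_zero v) (fun v => m.degree_X) (fun _ => one_pos)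
        (fun v => by rw [one_mul]; exact isWeightedHomogeneous_X k w v) L0 d]
    exact this
  have hmul := TwLin.multiset_of_card w hw0 L L0 a (fun _ => 1) ha0 (fun _ => one_pos) hcard
  have hLV : L = {v | (v.2 : ℕ) < lam' v.1} := by
    ext v
    constructor
    · intro hv
      have hgI : g v ∈ I := by rw [h6]; exact Ideal.subset_span ⟨v, hv, rfl⟩
      have hgr := Ideal.le_radical hgI
      rw [hrad, TwLin.std_mem] at hgr
      obtain ⟨u, hu, hne⟩ := hgr _ (m.degree_mem_support (h2 v))
      rw [h3, Finsupp.single_apply] at hne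
      have : v = u := by
        by_contra h
        exact hne (if_neg h)
      subst this
      exact hu
    · intro hv
      by_contra hvL
      have hX : (X v : MvPolynomial (Fin n × Fin N) k) ∈ I.radical := by
        rw [hrad]; exact Ideal.subset_span ⟨v, hv, rfl⟩
      obtain ⟨c, hc⟩ := hX
      obtain ⟨hgv, hlv⟩ := h5 v hvL
      have hb : TwLin.bb g a (Finsupp.single v c) = X v ^ c := by
        unfold TwLin.bb
        rw [Finset.prod_eq_single v]
        · simp [ha, hlv, hgv, Nat.mod_one]
        · intro u _ hu
          simp [hu.symm]
        · simp
      have hmem : TwLin.bb g a (Finsupp.single v c) ∈ I.restrictScalars k := by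
        rw [hb]; exact hc
      rw [h6, TwLin.ideal_eq m g a h2 h3 ha0 L] at hmem
      refine (TwLin.linInd_of_degree m (TwLin.bb g a) (TwLin.bb_ne g a h2)
        (TwLin.bb_degree m g a h2 h3)).notMem_span_image ?_ hmem
      rintro ⟨u, hu, hau⟩
      have huv : v ≠ u := fun h => hvL (h ▸ hu)
      rw [Finsupp.single_apply, if_neg huv] at hau
      exact absurd (ha0 u) (by omega)
  have hcount : ∀ M, ((L.toFinset).filter (fun v => l v < M)).card =
      (L0.toFinset.filter (fun v => (v.2 : ℕ) < M)).card := by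
    intro M
    have := congrArg (fun A => (A.filter (fun b => b < p ^ M)).card) hmul
    simp only [Multiset.filter_map, Multiset.card_map] at this
    have e1 : ∀ v, (((fun b => b < p ^ M) ∘ fun v => a v * w v) v) ↔ l v < M := by
      intro v
      simp only [Function.comp, haw]
      exact Nat.pow_lt_pow_iff_right hp.one_lt
    have e2 : ∀ v, (((fun b => b < p ^ M) ∘ fun v => 1 * w v) v) ↔ (v.2 : ℕ) < M := by
      intro v
      simp only [Function.comp, one_mul, hw]
      exact Nat.pow_lt_pow_iff_right hp.one_lt
    simp only [e1, e2] at this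
    rw [Finset.card_def, Finset.card_def, Finset.filter_val, Finset.filter_val]
    convert this
  have hcl : L.toFinset.card = L0.toFinset.card := by
    have := congrArg Multiset.card hmul
    simp only [Multiset.card_map] at this
    rw [Finset.card_def, Finset.card_def]
    convert this
  have hmin : ∀ M, ∑ i, min (lam i) M ≤ ∑ i, min (lam' i) M := by
    intro M
    rw [← TwLin.card_filter_min n N lam hlamN, ← TwLin.card_filter_min n N lam' hlam'N]
    have e : Finset.univ.filter (fun v : Fin n × Fin N => (v.2 : ℕ) < lam v.1 ∧ (v.2 : ℕ) < M) =
        L0.toFinset.filter (fun v => (v.2 : ℕ) < M) := by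
      ext v; simp [L0]
    rw [e, ← hcount]
    refine Finset.card_le_card ?_
    intro v hv
    simp only [Finset.mem_filter, Set.mem_toFinset] at hv
    have hv1 := hv.1
    rw [hLV] at hv1
    simp only [Finset.mem_filter, Finset.mem_univ, true_and]
    exact ⟨hv1, lt_of_le_of_lt (h1 v) hv.2⟩
  have hsum : ∑ i, lam' i = ∑ i, lam i := by
    have e : ∀ mu : Fin n → ℕ, (∀ i, mu i ≤ N) → ∑ i, mu i =
        ({v : Fin n × Fin N | (v.2 : ℕ) < mu v.1} : Set _).toFinset.card := by
      intro mu hmu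
      have h := TwLin.card_filter_min n N mu hmu N
      rw [Finset.sum_congr rfl (fun i _ => min_eq_left (hmu i))] at h
      rw [← h]
      congr 1
      ext v
      simp
    rw [e lam' hlam'N, e lam hlamN, ← hcl]
    congr 1
    ext v
    simp [hLV]
  exact ⟨hsum, fun r _ hr => TwLin.dominance n lam lam' hlam hsum hmin r hr⟩
end
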